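/- arXiv:2501.07281 — 2 statements merged into one kernel-verified Lean document; each statement's English description precedes it below -/
import Mathlib

section
/- Let a, b ∈ ℂ, c, c' ∈ ℂ \ ℤ_{≤0}, with a − b ∉ ℤ. For |arg(−x)| < π, |x| > 1 and |y| < ∞, the Humbert function Ψ₁ has the convergent expansion Ψ₁[a,b;c,c';x,y] = (Γ(c)Γ(b−a)/(Γ(b)Γ(c−a))) (−x)^{−a} Σ_{k≥0} ₁F₁[−k;c';y] (a)_k(1−c+a)_k/((1−b+a)_k k!) x^{−k} + (Γ(c)Γ(a−b)/(Γ(a)Γ(c−b))) (−x)^{−b} Σ_{k≥0} ₁F₁[a−b−k;c';y] (b)_k(1−c+b)_k/((1−a+b)_k k!) x^{−k}. -/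
open Complex

/-- Pochhammer symbol (rising factorial) on `ℂ`. -/
noncomputable def poch (a : ℂ) (n : ℕ) : ℂ := (ascPochhammer ℂ n).eval a

/-- Kummer confluent hypergeometric function `₁F₁[a; c; z]`. -/
noncomputable def F11 (a c z : ℂ) : ℂ :=
  ∑' n : ℕ, poch a n / poch c n * z ^ n / (Nat.factorial n : ℂ)

namespace Psi1

open Filter Topology

/-! ### Pochhammer symbols -/

lemma poch_zero (a : ℂ) : poch a 0 = 1 := by simp [poch]

lemma poch_succ (a : ℂ) (n : ℕ) : poch a (n + 1) = poch a n * (a + n) := by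
  simp [poch, ascPochhammer_succ_eval]

lemma poch_add (a : ℂ) (m n : ℕ) : poch a (m + n) = poch a m * poch (a + m) n := by
  induction n with
  | zero => simp [poch_zero]
  | succ n ih =>
    rw [← add_assoc, poch_succ, poch_succ, ih]
    push_cast
    ring

lemma poch_succ_left (a : ℂ) (n : ℕ) : poch a (n + 1) = a * poch (a + 1) n := by
  rw [add_comm, poch_add, poch_succ, poch_zero]
  simp

lemma add_mul_poch (a : ℂ) (n : ℕ) : (a + n) * poch a n = a * poch (a + 1) n := by
  rw [← poch_succ_left, poch_succ, mul_comm]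

lemma poch_one (n : ℕ) : poch 1 n = n.factorial := by
  simp [poch, ascPochhammer_eval_one]

lemma poch_ne_zero {c : ℂ} (hc : ∀ n : ℕ, c ≠ -n) (n : ℕ) : poch c n ≠ 0 := by
  induction n with
  | zero => simp [poch_zero]
  | succ n ih =>
    rw [poch_succ]
    exact mul_ne_zero ih fun h => hc n (eq_neg_of_add_eq_zero_left h)

lemma poch_eq_prod (a : ℂ) (n : ℕ) : poch a n = ∏ j ∈ Finset.range n, (a + j) := by
  induction n with
  | zero => simp [poch_zero]
  | succ n ih => rw [poch_succ, ih, Finset.prod_range_succ]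

lemma one_ne_neg_nat (n : ℕ) : (1 : ℂ) ≠ -n := by
  intro h
  have := congrArg re h
  simp at this
  have h2 : (0 : ℝ) ≤ n := n.cast_nonneg
  linarith

lemma tendsto_add_nat_div (a c : ℂ) :
    Tendsto (fun n : ℕ => (a + n) / (c + n)) atTop (𝓝 1) := by
  have h (z : ℂ) : Tendsto (fun n : ℕ => z / n + 1) atTop (𝓝 1) := by
    have := (tendsto_const_div_atTop_nhds_zero_nat z).add_const (1 : ℂ)
    simpa using this
  have := (h a).div (h c) one_ne_zero
  rw [div_one] at this
  refine this.congr' ?_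
  filter_upwards [eventually_ge_atTop 1] with n hn
  have hn' : (n : ℂ) ≠ 0 := by exact_mod_cast (by omega : n ≠ 0)
  simp only [Pi.div_apply]
  rw [div_add_one hn', div_add_one hn', div_div_div_cancel_right₀ hn']

/-- Sequences of subexponential growth. -/
def Subexp (t : ℕ → ℂ) : Prop := ∀ ρ : ℝ, 1 < ρ → ∃ C : ℝ, 0 ≤ C ∧ ∀ n, ‖t n‖ ≤ C * ρ ^ n

lemma subexp_of_ratio {t : ℕ → ℂ} (q : ℕ → ℂ) (hq : Tendsto q atTop (𝓝 1))
    (ht : ∀ n, t (n + 1) = q n * t n) : Subexp t := by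
  intro ρ hρ
  have h1 : ∀ᶠ n in atTop, ‖q n‖ < ρ := by
    have := hq.norm
    rw [norm_one] at this
    exact this.eventually_lt_const hρ
  obtain ⟨N, hN⟩ := eventually_atTop.1 h1
  have hρ0 : 0 < ρ := by linarith
  refine ⟨∑ j ∈ Finset.range (N + 1), ‖t j‖, by positivity, fun n => ?_⟩
  induction n with
  | zero =>
    simpa using Finset.single_le_sum (f := fun j => ‖t j‖) (fun _ _ => norm_nonneg _)
      (Finset.mem_range.2 (Nat.succ_pos N))
  | succ n ih =>
    rcases le_or_gt N n with h | h
    · rw [ht, norm_mul, pow_succ]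
      calc ‖q n‖ * ‖t n‖ ≤ ρ * ((∑ j ∈ Finset.range (N + 1), ‖t j‖) * ρ ^ n) :=
            mul_le_mul (hN n h).le ih (norm_nonneg _) hρ0.le
        _ = _ := by ring
    · calc ‖t (n + 1)‖ ≤ ∑ j ∈ Finset.range (N + 1), ‖t j‖ :=
            Finset.single_le_sum (f := fun j => ‖t j‖) (fun _ _ => norm_nonneg _)
              (Finset.mem_range.2 (by omega))
        _ ≤ _ := le_mul_of_one_le_right (by positivity) (one_le_pow₀ hρ.le)

lemma Subexp.mul {s t : ℕ → ℂ} (hs : Subexp s) (ht : Subexp t) :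
    Subexp (fun n => s n * t n) := by
  intro ρ hρ
  have h1 : 1 < √ρ := by rw [Real.lt_sqrt zero_le_one]; simpa using hρ
  obtain ⟨C, hC, h⟩ := hs _ h1
  obtain ⟨D, hD, k⟩ := ht _ h1
  refine ⟨C * D, mul_nonneg hC hD, fun n => ?_⟩
  rw [norm_mul]
  calc ‖s n‖ * ‖t n‖ ≤ (C * √ρ ^ n) * (D * √ρ ^ n) :=
        mul_le_mul (h n) (k n) (norm_nonneg _) (by positivity)
    _ = C * D * (√ρ * √ρ) ^ n := by rw [mul_pow]; ring
    _ = _ := by rw [Real.mul_self_sqrt (by linarith)]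

lemma Subexp.add {s t : ℕ → ℂ} (hs : Subexp s) (ht : Subexp t) :
    Subexp (fun n => s n + t n) := by
  intro ρ hρ
  obtain ⟨C, hC, h⟩ := hs _ hρ
  obtain ⟨D, hD, k⟩ := ht _ hρ
  exact ⟨C + D, add_nonneg hC hD, fun n => (norm_add_le _ _).trans (by linarith [h n, k n])⟩

lemma subexp_const (c : ℂ) : Subexp (fun _ => c) := by
  intro ρ hρ
  exact ⟨‖c‖, norm_nonneg _, fun n =>
    le_mul_of_one_le_right (norm_nonneg _) (one_le_pow₀ hρ.le)⟩

lemma subexp_poch_div (a c : ℂ) :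
    Subexp (fun n => poch a n / poch c n) := by
  refine subexp_of_ratio _ (tendsto_add_nat_div a c) fun n => ?_
  rw [poch_succ, poch_succ, mul_div_mul_comm, mul_comm]

lemma subexp_natCast : Subexp (fun n => (n : ℂ)) := by
  have h := subexp_poch_div 2 1
  have h2 : ∀ n : ℕ, poch 2 n / poch 1 n = n + 1 := by
    intro n
    rw [div_eq_iff (poch_ne_zero one_ne_neg_nat n)]
    have := add_mul_poch 1 n
    rw [one_mul, one_add_one_eq_two] at this
    rw [← this]; ring
  simp only [h2] at h
  simpa using h.add (subexp_const (-1))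

/-! ### Power series with subexponential coefficients -/

lemma summable_norm_mul_pow {t : ℕ → ℂ} (ht : Subexp t) {z : ℂ} (hz : ‖z‖ < 1) :
    Summable (fun n => ‖t n * z ^ n‖) := by
  obtain ⟨s, hs, hs1⟩ := exists_between hz
  have hs0 : 0 < s := (norm_nonneg z).trans_lt hs
  obtain ⟨C, hC, h⟩ := ht s⁻¹ ((one_lt_inv₀ hs0).2 hs1)
  refine Summable.of_nonneg_of_le (fun _ => norm_nonneg _) (fun n => ?_)
    ((summable_geometric_of_lt_one (r := ‖z‖ / s) (by positivity)
      ((div_lt_one hs0).2 hs)).mul_left C)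
  rw [norm_mul, norm_pow]
  calc ‖t n‖ * ‖z‖ ^ n ≤ C * s⁻¹ ^ n * ‖z‖ ^ n := by gcongr; exact h n
    _ = _ := by rw [div_pow, inv_pow]; ring

/-- The sum of a power series. -/
noncomputable def pser (t : ℕ → ℂ) (z : ℂ) : ℂ := ∑' n, t n * z ^ n

lemma summable_pser {t : ℕ → ℂ} (ht : Subexp t) {z : ℂ} (hz : ‖z‖ < 1) :
    Summable (fun n => t n * z ^ n) := (summable_norm_mul_pow ht hz).of_norm

lemma pser_zero (t : ℕ → ℂ) : pser t 0 = t 0 := by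
  rw [pser, tsum_eq_single 0 (fun n hn => by simp [hn])]
  simp

lemma pser_shift {t : ℕ → ℂ} (ht : Subexp t) (h0 : t 0 = 0) {z : ℂ} (hz : ‖z‖ < 1) :
    pser t z = z * pser (fun n => t (n + 1)) z := by
  rw [pser, (summable_pser ht hz).tsum_eq_zero_add, h0, pser, ← tsum_mul_left]
  simp only [zero_mul, zero_add]
  congr 1; ext n; ring

lemma pser_add {s t : ℕ → ℂ} (hs : Subexp s) (ht : Subexp t) {z : ℂ} (hz : ‖z‖ < 1) :
    pser (fun n => s n + t n) z = pser s z + pser t z := by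
  simp only [pser, add_mul]
  exact (summable_pser hs hz).tsum_add (summable_pser ht hz)

lemma pser_const_mul (c : ℂ) (t : ℕ → ℂ) (z : ℂ) :
    pser (fun n => c * t n) z = c * pser t z := by
  simp only [pser, mul_assoc, tsum_mul_left]

lemma differentiableOn_pser {t : ℕ → ℂ} (ht : Subexp t) :
    DifferentiableOn ℂ (pser t) (Metric.ball 0 1) := by
  intro z hz
  rw [mem_ball_zero_iff] at hz
  obtain ⟨s, hs, hs1⟩ := exists_between hz
  have hs0 : 0 < s := (norm_nonneg z).trans_lt hs
  have hs' : ‖(s : ℂ)‖ < 1 := by rwa [norm_real, Real.norm_of_nonneg hs0.le]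
  have := differentiableOn_tsum_of_summable_norm (F := fun n z => t n * z ^ n)
    (summable_norm_mul_pow ht hs') (fun n => by fun_prop) Metric.isOpen_ball
    (U := Metric.ball 0 s) (fun n w hw => by
      rw [mem_ball_zero_iff] at hw
      rw [norm_mul, norm_mul, norm_pow, norm_pow, norm_real, Real.norm_of_nonneg hs0.le]
      gcongr)
  exact ((this z (by simpa using hs)).differentiableAt
    (Metric.isOpen_ball.mem_nhds (by simpa using hs))).differentiableWithinAt

lemma differentiableAt_pser {t : ℕ → ℂ} (ht : Subexp t) {z : ℂ} (hz : ‖z‖ < 1) :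
    DifferentiableAt ℂ (pser t) z :=
  (differentiableOn_pser ht).differentiableAt (Metric.isOpen_ball.mem_nhds (by simpa using hz))

lemma mul_deriv_pser {t : ℕ → ℂ} (ht : Subexp t) {z : ℂ} (hz : ‖z‖ < 1) :
    z * deriv (pser t) z = pser (fun n => n * t n) z := by
  obtain ⟨s, hs, hs1⟩ := exists_between hz
  have hs0 : 0 < s := (norm_nonneg z).trans_lt hs
  have hs' : ‖(s : ℂ)‖ < 1 := by rwa [norm_real, Real.norm_of_nonneg hs0.le]
  have := hasSum_deriv_of_summable_norm (F := fun n z => t n * z ^ n)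
    (summable_norm_mul_pow ht hs') (fun n => by fun_prop) Metric.isOpen_ball
    (U := Metric.ball 0 s) (fun n w hw => by
      rw [mem_ball_zero_iff] at hw
      rw [norm_mul, norm_mul, norm_pow, norm_pow, norm_real, Real.norm_of_nonneg hs0.le]
      gcongr) (z := z) (by simpa using hs)
  have h2 := this.mul_left z
  rw [show pser t = fun w => ∑' n, t n * w ^ n from rfl, ← h2.tsum_eq, pser]
  congr 1; ext n
  rw [deriv_const_mul _ (by fun_prop), deriv_pow_field]
  rcases n with _ | n
  · simp
  · simp only [Nat.add_sub_cancel]; ring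

lemma pser_quadratic {t : ℕ → ℂ} (ht : Subexp t) (p q : ℂ) {z : ℂ} (hz : ‖z‖ < 1) :
    pser (fun n => (n * (n * t n)) + (p * (n * t n) + q * t n)) z =
      pser (fun n => n * (n * t n)) z + p * pser (fun n => n * t n) z + q * pser t z := by
  have h1 := subexp_natCast.mul ht
  rw [pser_add (subexp_natCast.mul h1) (((subexp_const p).mul h1).add ((subexp_const q).mul ht)) hz,
    pser_add ((subexp_const p).mul h1) ((subexp_const q).mul ht) hz, pser_const_mul,
    pser_const_mul]
  ring

/-! ### The Gauss hypergeometric series -/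

/-- Taylor coefficients of the Gauss hypergeometric function. -/
noncomputable def hco (a b c : ℂ) (k : ℕ) : ℂ :=
  poch a k * poch b k / (poch c k * (k.factorial : ℂ))

lemma subexp_hco (a b c : ℂ) : Subexp (hco a b c) := by
  have := (subexp_poch_div a c).mul (subexp_poch_div b 1)
  convert this using 2 with n
  rw [hco, poch_one, mul_div_mul_comm]

lemma hco_zero (a b c : ℂ) : hco a b c 0 = 1 := by simp [hco, poch_zero]

lemma hco_comm (a b c : ℂ) : hco a b c = hco b a c := by
  ext k; rw [hco, hco, mul_comm (poch a k)]

lemma hco_succ (a b : ℂ) {c : ℂ} (hc : ∀ n : ℕ, c ≠ -n) (k : ℕ) :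
    (k + 1) * (c + k) * hco a b c (k + 1) = (a + k) * (b + k) * hco a b c k := by
  have h1 := poch_ne_zero hc k
  have h2 := poch_ne_zero hc (k + 1)
  rw [poch_succ] at h2
  have h3 := right_ne_zero_of_mul h2
  have h4 : (k.factorial : ℂ) ≠ 0 := by exact_mod_cast k.factorial_ne_zero
  have h5 : (k + 1 : ℂ) ≠ 0 := by exact_mod_cast k.succ_ne_zero
  simp only [hco, poch_succ, Nat.factorial_succ]
  push_cast
  field_simp

lemma hco_raise_b (a b c : ℂ) (k : ℕ) :
    k * hco a b c k + b * hco a b c k = b * hco a (b + 1) c k := by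
  have := add_mul_poch b k
  simp only [hco]
  linear_combination (poch a k / (poch c k * (k.factorial : ℂ))) * this

lemma hco_raise_c (a b : ℂ) {c : ℂ} (hc : ∀ n : ℕ, c ≠ -n) (k : ℕ) :
    k * hco a b (c + 1) k + c * hco a b (c + 1) k = c * hco a b c k := by
  have hc0 : c ≠ 0 := by simpa using hc 0
  have h1 := poch_ne_zero hc k
  have h2 := add_mul_poch c k
  have h3 : poch (c + 1) k ≠ 0 := by
    have := poch_ne_zero hc (k + 1)
    rw [poch_succ_left] at this
    exact right_ne_zero_of_mul this
  have h4 : (k.factorial : ℂ) ≠ 0 := by exact_mod_cast k.factorial_ne_zero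
  simp only [hco]
  field_simp
  linear_combination poch a k * poch b k * h2

/-! ### The Pfaff transformation -/

lemma one_sub_cpow_neg (s : ℂ) {x : ℂ} (hx : ‖x‖ < 1) :
    (1 - x) ^ (-s) = pser (fun j => poch s j / (j.factorial : ℂ)) x := by
  have h := (one_div_one_sub_cpow_hasFPowerSeriesOnBall_zero s).hasSum (y := x) (by
    rw [Metric.mem_eball, edist_zero_right]
    rw [← ofReal_norm, ENNReal.ofReal_lt_one]
    exact hx)
  rw [cpow_neg, ← one_div]
  rw [zero_add] at h
  rw [← h.tsum_eq, pser]
  congr 1; ext n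
  have h1 := Ring.factorial_nsmul_multichoose_eq_ascPochhammer s n
  rw [Ring.multichoose_eq, nsmul_eq_mul, Polynomial.ascPochhammer_smeval_eq_eval] at h1
  have h4 : (n.factorial : ℂ) ≠ 0 := by exact_mod_cast n.factorial_ne_zero
  rw [poch, ← h1, mul_div_cancel_left₀ _ h4]
  simp [mul_comm]

lemma tsum_antidiagonal {f : ℕ × ℕ → ℂ} (hf : Summable f) :
    ∑' p, f p = ∑' k, ∑ p ∈ Finset.HasAntidiagonal.antidiagonal k, f p := by
  let e := Finset.HasAntidiagonal.sigmaAntidiagonalEquivProd (A := ℕ)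
  rw [← e.tsum_eq]
  refine ((e.summable_iff.2 hf).tsum_sigma' fun n => (hasSum_fintype _).summable).trans ?_
  congr 1; ext k
  rw [tsum_fintype, ← Finset.sum_coe_sort (Finset.HasAntidiagonal.antidiagonal k)]
  rfl

lemma choose_le_of_pos {s : ℝ} (hs : 0 < s) (N n : ℕ) :
    (N.choose n : ℝ) ≤ (1 + s) ^ N * s⁻¹ ^ n := by
  have h : (N.choose n : ℝ) * s ^ n ≤ (1 + s) ^ N := by
    rw [add_comm, add_pow]
    rcases le_or_gt n N with h | h
    · refine le_trans (le_of_eq ?_) (Finset.single_le_sum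
        (f := fun m => s ^ m * 1 ^ (N - m) * (N.choose m : ℝ)) (fun _ _ => by positivity)
        (Finset.mem_range.2 (Nat.lt_succ_of_le h)))
      simp [mul_comm]
    · rw [Nat.choose_eq_zero_of_lt h]
      simp only [Nat.cast_zero, zero_mul]
      exact Finset.sum_nonneg fun _ _ => by positivity
  rw [inv_pow, ← div_eq_mul_inv, le_div_iff₀ (by positivity)]
  exact h

/-- A growth bound for `(a)_{m+n} / (m! n!)`. -/
lemma exists_bound_poch_add (a : ℂ) {s : ℝ} (hs : 0 < s) :
    ∃ C : ℝ, 0 ≤ C ∧ ∀ m n : ℕ,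
      ‖poch a (m + n) / ((m.factorial : ℂ) * (n.factorial : ℂ))‖
        ≤ C * (1 + s) ^ m * ((1 + s) * (1 + 2 * s⁻¹)) ^ n := by
  obtain ⟨C, hC, h⟩ := subexp_poch_div a 1 (√(1 + s)) (by
    rw [Real.lt_sqrt zero_le_one]; linarith)
  have h1 : 1 < √(1 + s) := by rw [Real.lt_sqrt zero_le_one]; linarith
  set σ := √(1 + s) - 1 with hσ
  have hσ0 : 0 < σ := by linarith
  have hsq : (1 + σ) * (1 + σ) = 1 + s := by
    rw [hσ, add_sub_cancel]; exact Real.mul_self_sqrt (by linarith)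
  have hσi : σ⁻¹ ≤ 1 + 2 * s⁻¹ := by
    have : s = σ * (2 + σ) := by linarith
    rw [this, mul_inv, inv_le_iff_one_le_mul₀ hσ0]
    have h2 : (2 + σ) * (2 + σ)⁻¹ = 1 := mul_inv_cancel₀ (by positivity)
    have h3 : σ * σ⁻¹ = 1 := mul_inv_cancel₀ (by positivity)
    have h4 : 0 < (2 + σ)⁻¹ := by positivity
    have : σ * (1 + 2 * (σ⁻¹ * (2 + σ)⁻¹)) = σ + 2 * (2 + σ)⁻¹ := by
      linear_combination 2 * (2 + σ)⁻¹ * h3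
    nlinarith
  refine ⟨C, hC, fun m n => ?_⟩
  have hch : ((m + n).factorial : ℝ) = (m + n).choose n * (m.factorial * n.factorial) := by
    have := Nat.add_choose_mul_factorial_mul_factorial m n
    rw [← this]
    push_cast; ring
  have h2 : ‖poch a (m + n) / poch 1 (m + n)‖ ≤ C * √(1 + s) ^ (m + n) := h (m + n)
  rw [poch_one, norm_div, norm_natCast, div_le_iff₀ (by positivity), hch] at h2
  rw [norm_div, norm_mul, norm_natCast, norm_natCast, div_le_iff₀ (by positivity)]
  refine h2.trans ?_
  rw [← mul_assoc (C * √(1 + s) ^ (m + n))]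
  refine mul_le_mul_of_nonneg_right ?_ (by positivity)
  have h3 := choose_le_of_pos hσ0 (m + n) n
  have e1 : √(1 + s) = 1 + σ := by rw [hσ]; ring
  rw [e1]
  calc C * (1 + σ) ^ (m + n) * ((m + n).choose n : ℝ)
      ≤ C * (1 + σ) ^ (m + n) * ((1 + σ) ^ (m + n) * σ⁻¹ ^ n) := by gcongr
    _ = C * ((1 + σ) * (1 + σ)) ^ m * (((1 + σ) * (1 + σ)) * σ⁻¹) ^ n := by
        rw [mul_pow, mul_pow, mul_pow]; ring
    _ ≤ _ := by rw [hsq]; gcongr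

lemma chu_vandermonde (k : ℕ) : ∀ (β c : ℂ), (∀ n : ℕ, c ≠ -n) →
    ∑ p ∈ Finset.HasAntidiagonal.antidiagonal k, (-1) ^ p.1 * (k.choose p.1 : ℂ) *
      (poch β p.1 / poch c p.1) =
      poch (c - β) k / poch c k := by
  induction k with
  | zero => intro β c _; simp [poch_zero]
  | succ k ih =>
    intro β c hc
    have hc0 : c ≠ 0 := by simpa using hc 0
    have hc1 : ∀ n : ℕ, c + 1 ≠ -n := fun n h => hc (n + 1) (by push_cast; linear_combination h)
    have e1 := ih β c hc
    have e2 := ih (β + 1) (c + 1) hc1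
    rw [Finset.Nat.sum_antidiagonal_eq_sum_range_succ_mk] at e1 e2 ⊢
    have key : ∀ m : ℕ, (-1 : ℂ) ^ (m + 1) * ((k + 1).choose (m + 1) : ℂ) *
        (poch β (m + 1) / poch c (m + 1)) =
        (-1) ^ (m + 1) * (k.choose (m + 1) : ℂ) * (poch β (m + 1) / poch c (m + 1)) -
        (β / c) * ((-1) ^ m * (k.choose m : ℂ) * (poch (β + 1) m / poch (c + 1) m)) := by
      intro m
      rw [Nat.choose_succ_succ, poch_succ_left, poch_succ_left, mul_div_mul_comm]
      push_cast; ring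
    have e3 : ∑ m ∈ Finset.range (k + 1), (-1 : ℂ) ^ (m + 1) * (k.choose (m + 1) : ℂ) *
        (poch β (m + 1) / poch c (m + 1)) = poch (c - β) k / poch c k - 1 := by
      rw [← e1, Finset.sum_range_succ, Finset.sum_range_succ' _ k]
      simp [poch_zero]
    rw [Finset.sum_range_succ']
    simp only [key]
    rw [Finset.sum_sub_distrib, ← Finset.mul_sum, e2, e3]
    have h1 := poch_ne_zero hc k
    have h2 := poch_ne_zero hc1 k
    have h3 := poch_ne_zero hc (k + 1)
    rw [poch_succ] at h3
    have h4 := right_ne_zero_of_mul h3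
    have h5 := add_mul_poch c k
    rw [show c + 1 - (β + 1) = c - β by ring, poch_succ, poch_succ]
    simp only [pow_zero, Nat.choose_zero_right, poch_zero]
    have h6 : poch (c + 1) k = (c + k) * poch c k / c := by rw [h5]; field_simp
    rw [h6]
    field_simp
    push_cast
    ring

lemma poch_div_natCast_choose (a : ℂ) (m j : ℕ) :
    poch a (m + j) / ((m.factorial : ℂ) * (j.factorial : ℂ)) =
      poch a (m + j) / ((m + j).factorial : ℂ) * ((m + j).choose m : ℂ) := by
  have := Nat.add_choose_mul_factorial_mul_factorial m j
  have h1 : ((m + j).factorial : ℂ) ≠ 0 := by exact_mod_cast (m + j).factorial_ne_zero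
  have h2 : (m.factorial : ℂ) ≠ 0 := by exact_mod_cast m.factorial_ne_zero
  have h3 : (j.factorial : ℂ) ≠ 0 := by exact_mod_cast j.factorial_ne_zero
  rw [div_mul_eq_mul_div, div_eq_div_iff (mul_ne_zero h2 h3) h1, ← this, Nat.choose_symm_add]
  push_cast; ring

/-- The Pfaff transformation of the Gauss series, near the origin. -/
lemma pfaff_of_norm_lt (a b : ℂ) {c : ℂ} (hc : ∀ n : ℕ, c ≠ -n) {x : ℂ} (hx : ‖x‖ < 1 / 16) :
    (1 - x) ^ (-a) * pser (hco a (c - b) c) (x / (x - 1)) = pser (hco a b c) x := by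
  have hx1 : ‖x‖ < 1 := by linarith
  have h1x : (1 : ℂ) - x ≠ 0 := by
    intro h
    rw [← sub_eq_zero.1 h, norm_one] at hx1
    exact lt_irrefl _ hx1
  set f : ℕ × ℕ → ℂ := fun p => poch a (p.1 + p.2) / ((p.1.factorial : ℂ) * (p.2.factorial : ℂ)) *
    (poch (c - b) p.1 / poch c p.1) * (-1) ^ p.1 * x ^ (p.1 + p.2) with hf
  have hsum : Summable f := by
    obtain ⟨C, hC, h⟩ := exists_bound_poch_add a one_pos
    obtain ⟨D, hD, h'⟩ := subexp_poch_div (c - b) c 2 one_lt_two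
    have hg : Summable fun p : ℕ × ℕ => (C * D) * ((1 / 4 : ℝ) ^ p.1 * (3 / 8 : ℝ) ^ p.2) :=
      ((summable_geometric_of_lt_one (by norm_num) (by norm_num)).mul_of_nonneg
        (summable_geometric_of_lt_one (by norm_num) (by norm_num))
        (fun _ => by positivity) (fun _ => by positivity)).mul_left _
    refine Summable.of_norm_bounded hg fun p => ?_
    rw [hf]
    simp only [norm_mul, norm_pow, norm_neg, norm_one, one_pow, mul_one]
    have k1 := h p.1 p.2
    have k2 := h' p.1
    calc _ ≤ (C * (1 + 1) ^ p.1 * ((1 + 1) * (1 + 2 * 1⁻¹)) ^ p.2) * (D * 2 ^ p.1) *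
          (1 / 16) ^ (p.1 + p.2) := by gcongr
      _ = (C * D) * ((2 * 2 * (1 / 16)) ^ p.1 * (((1 + 1) * (1 + 2 * 1⁻¹)) * (1 / 16)) ^ p.2) := by
        simp only [mul_pow, pow_add]
        norm_num
        ring
      _ = _ := by norm_num
  have e1 : ∑' p, f p = (1 - x) ^ (-a) * pser (hco a (c - b) c) (x / (x - 1)) := by
    rw [hsum.tsum_prod' fun m => hsum.prod_factor m, pser, ← tsum_mul_left]
    congr 1; ext m
    have e2 : (1 - x) ^ (-a) * (x / (x - 1)) ^ m = (-1) ^ m * x ^ m * (1 - x) ^ (-(a + m)) := by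
      rw [neg_add, cpow_add _ _ h1x, cpow_neg _ (m : ℂ), cpow_natCast,
        show x / (x - 1) = (-1) * x * (1 - x)⁻¹ by
          rw [← neg_sub 1 x, div_neg, div_eq_mul_inv]; ring, mul_pow, mul_pow, inv_pow]
      ring
    calc ∑' j, f (m, j) = ∑' j, (hco a (c - b) c m * ((-1) ^ m * x ^ m)) *
          (poch (a + m) j / (j.factorial : ℂ) * x ^ j) := by
          congr 1; ext j
          simp only [hf, hco, poch_add, pow_add, div_eq_mul_inv, mul_inv]
          ring
      _ = _ := by
        rw [tsum_mul_left, ← pser, ← one_sub_cpow_neg _ hx1, mul_assoc, ← e2]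
        ring
  rw [← e1, tsum_antidiagonal hsum, pser]
  congr 1; ext k
  have e3 := chu_vandermonde k (c - b) c hc
  rw [sub_sub_cancel] at e3
  calc ∑ p ∈ Finset.HasAntidiagonal.antidiagonal k, f p
      = ∑ p ∈ Finset.HasAntidiagonal.antidiagonal k, poch a k / (k.factorial : ℂ) * x ^ k *
        ((-1) ^ p.1 * (k.choose p.1 : ℂ) * (poch (c - b) p.1 / poch c p.1)) := by
        refine Finset.sum_congr rfl fun p hp => ?_
        rw [Finset.HasAntidiagonal.mem_antidiagonal] at hp
        simp only [hf]
        rw [poch_div_natCast_choose, hp]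
        ring
    _ = _ := by
        rw [← Finset.mul_sum, e3, hco, div_mul_eq_mul_div, div_mul_div_comm, div_mul_eq_mul_div,
          mul_comm (k.factorial : ℂ)]
        ring

/-- The hypergeometric differential equation at the level of power series. -/
lemma pser_hco_ode (a b : ℂ) {c : ℂ} (hc : ∀ n : ℕ, c ≠ -n) {z : ℂ} (hz : ‖z‖ < 1) :
    pser (fun n => n * (n * hco a b c n)) z + (c - 1) * pser (fun n => n * hco a b c n) z =
      z * (pser (fun n => n * (n * hco a b c n)) z + (a + b) * pser (fun n => n * hco a b c n) z +
        a * b * pser (hco a b c) z) := by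
  have ht := subexp_hco a b c
  have h1 := subexp_natCast.mul ht
  rw [← pser_quadratic ht (a + b) (a * b) hz, ← pser_const_mul,
    ← pser_add (subexp_natCast.mul h1) ((subexp_const _).mul h1) hz,
    pser_shift ((subexp_natCast.mul h1).add ((subexp_const _).mul h1)) (by simp) hz]
  congr 2
  ext k
  have := hco_succ a b hc k
  push_cast
  linear_combination this

/-! ### Continuation of the Gauss function to a half plane -/

/-- The Gauss hypergeometric function on the half plane `re x < 1 / 2`. -/
noncomputable def fc (a b c x : ℂ) : ℂ := (1 - x) ^ (-a) * pser (hco a (c - b) c) (x / (x - 1))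

lemma isOpen_halfPlane (r : ℝ) : IsOpen {x : ℂ | x.re < r} :=
  isOpen_lt continuous_re continuous_const

lemma convex_halfPlane (r : ℝ) : Convex ℝ {x : ℂ | x.re < r} := convex_halfSpace_re_lt r

lemma norm_div_sub_one_lt {x : ℂ} (hx : x.re < 1 / 2) : ‖x / (x - 1)‖ < 1 := by
  have h1 : x - 1 ≠ 0 := by
    intro h
    rw [sub_eq_zero.1 h] at hx
    norm_num at hx
  rw [norm_div, div_lt_one (norm_pos_iff.2 h1), ← sq_lt_sq₀ (norm_nonneg _) (norm_nonneg _),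
    ← normSq_eq_norm_sq, ← normSq_eq_norm_sq, normSq_apply, normSq_apply]
  simp
  nlinarith

lemma one_sub_mem_slitPlane {x : ℂ} (hx : x.re < 1) : 1 - x ∈ slitPlane := by
  left; simp; linarith

lemma sub_one_ne_zero {x : ℂ} (hx : x.re < 1) : x - 1 ≠ 0 := by
  rw [← neg_sub, neg_ne_zero]
  exact slitPlane_ne_zero (one_sub_mem_slitPlane hx)

lemma differentiableAt_fc (a b c : ℂ) {x : ℂ} (hx : x.re < 1 / 2) :
    DifferentiableAt ℂ (fc a b c) x := by
  have hx1 : x.re < 1 := by linarith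
  have h1 : DifferentiableAt ℂ (fun x : ℂ => (1 - x) ^ (-a)) x :=
    (differentiableAt_id.const_sub 1).cpow_const (one_sub_mem_slitPlane hx1)
  have h2 : DifferentiableAt ℂ (fun x : ℂ => x / (x - 1)) x :=
    differentiableAt_id.div (differentiableAt_id.sub_const 1) (sub_one_ne_zero hx1)
  have h3 := (differentiableAt_pser (subexp_hco a (c - b) c) (norm_div_sub_one_lt hx)).comp x h2
  exact h1.mul h3

lemma differentiableOn_fc (a b c : ℂ) : DifferentiableOn ℂ (fc a b c) {x | x.re < 1 / 2} :=
  fun _ hx => (differentiableAt_fc a b c hx).differentiableWithinAt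

lemma fc_eventuallyEq (a b : ℂ) {c : ℂ} (hc : ∀ n : ℕ, c ≠ -n) :
    fc a b c =ᶠ[𝓝 0] pser (hco a b c) := by
  filter_upwards [Metric.ball_mem_nhds (0 : ℂ) (ε := 1 / 16) (by norm_num)] with x hx
  exact pfaff_of_norm_lt a b hc (by simpa using hx)

/-- The Euler operator `x d/dx`. -/
noncomputable def euler (f : ℂ → ℂ) (x : ℂ) : ℂ := x * deriv f x

lemma differentiableOn_euler {f : ℂ → ℂ} {s : Set ℂ} (hs : IsOpen s) (hf : DifferentiableOn ℂ f s) :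
    DifferentiableOn ℂ (euler f) s := differentiableOn_id.mul (hf.deriv hs)

lemma euler_eventuallyEq {f g : ℂ → ℂ} {x : ℂ} (h : f =ᶠ[𝓝 x] g) : euler f =ᶠ[𝓝 x] euler g := by
  filter_upwards [h.deriv] with y hy
  rw [euler, euler, hy]

lemma euler_pser {t : ℕ → ℂ} (ht : Subexp t) :
    euler (pser t) =ᶠ[𝓝 0] pser (fun n => n * t n) := by
  filter_upwards [Metric.ball_mem_nhds (0 : ℂ) one_pos] with x hx
  exact mul_deriv_pser ht (by simpa using hx)

lemma eqOn_halfPlane {f g : ℂ → ℂ} (hf : DifferentiableOn ℂ f {x | x.re < 1 / 2})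
    (hg : DifferentiableOn ℂ g {x | x.re < 1 / 2}) (h : f =ᶠ[𝓝 0] g) {x : ℂ} (hx : x.re < 1 / 2) :
    f x = g x :=
  (hf.analyticOnNhd (isOpen_halfPlane _)).eqOn_of_preconnected_of_eventuallyEq
    (hg.analyticOnNhd (isOpen_halfPlane _)) (convex_halfPlane _).isPreconnected
    (by simp) h hx

lemma fc_comm (a b : ℂ) {c : ℂ} (hc : ∀ n : ℕ, c ≠ -n) {x : ℂ} (hx : x.re < 1 / 2) :
    fc a b c x = fc b a c x := by
  refine eqOn_halfPlane (differentiableOn_fc a b c) (differentiableOn_fc b a c) ?_ hx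
  have h := fc_eventuallyEq b a hc
  rw [hco_comm] at h
  exact (fc_eventuallyEq a b hc).trans h.symm

lemma fc_raise_b (a b : ℂ) {c : ℂ} (hc : ∀ n : ℕ, c ≠ -n) {x : ℂ} (hx : x.re < 1 / 2) :
    euler (fc a b c) x + b * fc a b c x = b * fc a (b + 1) c x := by
  refine eqOn_halfPlane (f := fun x => euler (fc a b c) x + b * fc a b c x)
    (g := fun x => b * fc a (b + 1) c x)
    ((differentiableOn_euler (isOpen_halfPlane _) (differentiableOn_fc a b c)).add
      ((differentiableOn_fc a b c).const_mul b)) ((differentiableOn_fc a (b + 1) c).const_mul b) ?_ hx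
  have ht := subexp_hco a b c
  filter_upwards [fc_eventuallyEq a b hc, fc_eventuallyEq a (b + 1) hc,
    (euler_eventuallyEq (fc_eventuallyEq a b hc)).trans (euler_pser ht),
    Metric.ball_mem_nhds (0 : ℂ) one_pos] with x h1 h2 h3 h4
  rw [mem_ball_zero_iff] at h4
  rw [h1, h2, h3, ← pser_const_mul, ← pser_const_mul,
    ← pser_add (subexp_natCast.mul ht) ((subexp_const b).mul ht) h4]
  congr 1; ext k
  exact hco_raise_b a b c k

lemma fc_raise_c (a b : ℂ) {c : ℂ} (hc : ∀ n : ℕ, c ≠ -n) {x : ℂ} (hx : x.re < 1 / 2) :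
    euler (fc a b (c + 1)) x + c * fc a b (c + 1) x = c * fc a b c x := by
  have hc1 : ∀ n : ℕ, c + 1 ≠ -n := fun n h => hc (n + 1) (by push_cast; linear_combination h)
  refine eqOn_halfPlane (f := fun x => euler (fc a b (c + 1)) x + c * fc a b (c + 1) x)
    (g := fun x => c * fc a b c x)
    ((differentiableOn_euler (isOpen_halfPlane _) (differentiableOn_fc a b (c + 1))).add
      ((differentiableOn_fc a b (c + 1)).const_mul c)) ((differentiableOn_fc a b c).const_mul c) ?_ hx
  have ht := subexp_hco a b (c + 1)
  filter_upwards [fc_eventuallyEq a b hc, fc_eventuallyEq a b hc1,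
    (euler_eventuallyEq (fc_eventuallyEq a b hc1)).trans (euler_pser ht),
    Metric.ball_mem_nhds (0 : ℂ) one_pos] with x h1 h2 h3 h4
  rw [mem_ball_zero_iff] at h4
  rw [h1, h2, h3, ← pser_const_mul, ← pser_const_mul,
    ← pser_add (subexp_natCast.mul ht) ((subexp_const c).mul ht) h4]
  congr 1; ext k
  exact hco_raise_c a b hc k

/-- Solutions of the hypergeometric equation on the half plane `re x < -1`. -/
def IsSol (a b c : ℂ) (f : ℂ → ℂ) : Prop :=
  DifferentiableOn ℂ f {x | x.re < -1} ∧ ∀ x : ℂ, x.re < -1 →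
    euler (euler f) x + (c - 1) * euler f x =
      x * (euler (euler f) x + (a + b) * euler f x + a * b * f x)

lemma isSol_fc (a b : ℂ) {c : ℂ} (hc : ∀ n : ℕ, c ≠ -n) : IsSol a b c (fc a b c) := by
  refine ⟨(differentiableOn_fc a b c).mono fun x (hx : x.re < -1) => ?_, fun x hx => ?_⟩
  · change x.re < 1 / 2
    linarith
  have ho := isOpen_halfPlane (1 / 2)
  have d0 := differentiableOn_fc a b c
  have d1 := differentiableOn_euler ho d0
  have d2 := differentiableOn_euler ho d1
  refine eqOn_halfPlane (f := fun x => euler (euler (fc a b c)) x + (c - 1) * euler (fc a b c) x)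
    (g := fun x => x * (euler (euler (fc a b c)) x + (a + b) * euler (fc a b c) x +
      a * b * fc a b c x)) (d2.add (d1.const_mul _))
    (differentiableOn_id.mul ((d2.add (d1.const_mul _)).add (d0.const_mul _))) ?_ (by linarith)
  have ht := subexp_hco a b c
  have h0 := fc_eventuallyEq a b hc
  have h1 := (euler_eventuallyEq h0).trans (euler_pser ht)
  have h2 := (euler_eventuallyEq h1).trans (euler_pser (subexp_natCast.mul ht))
  filter_upwards [h0, h1, h2, Metric.ball_mem_nhds (0 : ℂ) one_pos] with x h0 h1 h2 h4
  rw [h0, h1, h2]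
  exact pser_hco_ode a b hc (by simpa using h4)

/-! ### Solutions at infinity -/

/-- A power of `-x` times a power series in `1 / x`. -/
noncomputable def gser (s : ℂ) (t : ℕ → ℂ) (x : ℂ) : ℂ := (-x) ^ (-s) * pser t x⁻¹

/-- The effect of the Euler operator on coefficients of a series at infinity. -/
noncomputable def lower (s : ℂ) (t : ℕ → ℂ) (k : ℕ) : ℂ := (-s) * t k + (-1) * (k * t k)

lemma Subexp.lower {t : ℕ → ℂ} (ht : Subexp t) (s : ℂ) : Subexp (lower s t) :=
  ((subexp_const _).mul ht).add ((subexp_const _).mul (subexp_natCast.mul ht))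

lemma pser_lower {t : ℕ → ℂ} (ht : Subexp t) (s : ℂ) {z : ℂ} (hz : ‖z‖ < 1) :
    pser (lower s t) z = -s * pser t z - pser (fun n => n * t n) z := by
  unfold Psi1.lower
  rw [pser_add ((subexp_const _).mul ht) ((subexp_const _).mul (subexp_natCast.mul ht)) hz,
    pser_const_mul, pser_const_mul]
  ring

lemma norm_inv_lt_one {x : ℂ} (hx : x.re < -1) : ‖x⁻¹‖ < 1 := by
  rw [norm_inv]
  refine inv_lt_one_of_one_lt₀ ?_
  have := abs_re_le_norm x
  rw [abs_of_neg (by linarith)] at this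
  linarith

lemma hasDerivAt_gser {t : ℕ → ℂ} (ht : Subexp t) (s : ℂ) {x : ℂ} (hx : x.re < -1) :
    HasDerivAt (gser s t) (gser s (lower s t) x / x) x := by
  have hs : -x ∈ slitPlane := by left; simp; linarith
  have hx0 : x ≠ 0 := by rintro rfl; norm_num at hx
  have hz := norm_inv_lt_one hx
  have h1 : HasDerivAt (fun x : ℂ => (-x) ^ (-s)) (-s * (-x) ^ (-s) / x) x := by
    have := (hasDerivAt_neg x).cpow_const (c := -s) hs
    refine this.congr_deriv ?_
    rw [cpow_sub _ _ (neg_ne_zero.2 hx0), cpow_one]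
    field_simp
  have h2 : HasDerivAt (fun x : ℂ => pser t x⁻¹) (deriv (pser t) x⁻¹ * (-(x ^ 2)⁻¹)) x :=
    (differentiableAt_pser ht hz).hasDerivAt.comp x (hasDerivAt_inv hx0)
  refine (h1.mul h2).congr_deriv ?_
  rw [gser, pser_lower ht s hz, ← mul_deriv_pser ht hz]
  field_simp
  ring

lemma differentiableOn_gser {t : ℕ → ℂ} (ht : Subexp t) (s : ℂ) :
    DifferentiableOn ℂ (gser s t) {x | x.re < -1} :=
  fun _ hx => (hasDerivAt_gser ht s hx).differentiableAt.differentiableWithinAt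

lemma euler_gser {t : ℕ → ℂ} (ht : Subexp t) (s : ℂ) {x : ℂ} (hx : x.re < -1) :
    euler (gser s t) x = gser s (lower s t) x := by
  have hx0 : x ≠ 0 := by rintro rfl; norm_num at hx
  rw [euler, (hasDerivAt_gser ht s hx).deriv, mul_div_cancel₀ _ hx0]

lemma euler_euler_gser {t : ℕ → ℂ} (ht : Subexp t) (s : ℂ) {x : ℂ} (hx : x.re < -1) :
    euler (euler (gser s t)) x = gser s (lower s (lower s t)) x := by
  have : euler (gser s t) =ᶠ[𝓝 x] gser s (lower s t) := by
    filter_upwards [(isOpen_halfPlane (-1)).mem_nhds hx] with y hy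
    exact euler_gser ht s hy
  rw [(euler_eventuallyEq this).eq_of_nhds, euler_gser (ht.lower s) s hx]

/-- The solution of the hypergeometric equation at infinity with exponent `a`. -/
noncomputable def gc (a b c : ℂ) : ℂ → ℂ := gser a (hco a (1 - c + a) (1 - b + a))

lemma isSol_gc {a b : ℂ} (c : ℂ) (hab : ∀ n : ℤ, a - b ≠ n) : IsSol a b c (gc a b c) := by
  have hd : ∀ n : ℕ, 1 - b + a ≠ -n := fun n h =>
    hab (-n - 1) (by push_cast; linear_combination h)
  have ht := subexp_hco a (1 - c + a) (1 - b + a)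
  refine ⟨differentiableOn_gser ht a, fun x hx => ?_⟩
  have hx0 : x ≠ 0 := by rintro rfl; norm_num at hx
  have hz := norm_inv_lt_one hx
  have h := pser_hco_ode a (1 - c + a) hd hz
  rw [gc, euler_euler_gser ht a hx, euler_gser ht a hx]
  have e2 : pser (fun n => n * lower a (hco a (1 - c + a) (1 - b + a)) n) x⁻¹ =
      -a * pser (fun n => n * hco a (1 - c + a) (1 - b + a) n) x⁻¹ -
      pser (fun n => n * (n * hco a (1 - c + a) (1 - b + a) n)) x⁻¹ := by
    rw [← pser_lower (subexp_natCast.mul ht) a hz]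
    congr 1; ext n; simp only [lower]; ring
  simp only [gser]
  rw [pser_lower (ht.lower a) a hz, e2, pser_lower ht a hz]
  rw [eq_inv_mul_iff_mul_eq₀ hx0] at h
  linear_combination (-(-x) ^ (-a)) * h

lemma IsSol.symm {a b c : ℂ} {f : ℂ → ℂ} (h : IsSol a b c f) : IsSol b a c f :=
  ⟨h.1, fun x hx => by rw [h.2 x hx]; ring⟩

/-- The Wronskian with respect to the Euler operator. -/
noncomputable def wr (p q : ℂ → ℂ) (x : ℂ) : ℂ := p x * euler q x - q x * euler p x

/-- The Abel identity. -/
lemma exists_wr_eq {a b c : ℂ} {p q : ℂ → ℂ} (hp : IsSol a b c p) (hq : IsSol a b c q) :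
    ∃ K, ∀ x : ℂ, x.re < -1 → wr p q x * ((-x) ^ (c - 1) * (1 - x) ^ (a + b + 1 - c)) = K := by
  have ho := isOpen_halfPlane (-1)
  have hder : ∀ x : ℂ, x.re < -1 →
      HasDerivAt (fun x => wr p q x * ((-x) ^ (c - 1) * (1 - x) ^ (a + b + 1 - c))) 0 x := by
    intro x hx
    have hs : -x ∈ slitPlane := by left; simp; linarith
    have hs1 : 1 - x ∈ slitPlane := one_sub_mem_slitPlane (by linarith)
    have hx0 : x ≠ 0 := by rintro rfl; norm_num at hx
    have hx1 : 1 - x ≠ 0 := slitPlane_ne_zero hs1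
    have hn := ho.mem_nhds hx
    have p1 := (hp.1.differentiableAt hn).hasDerivAt
    have q1 := (hq.1.differentiableAt hn).hasDerivAt
    have p2 := ((differentiableOn_euler ho hp.1).differentiableAt hn).hasDerivAt
    have q2 := ((differentiableOn_euler ho hq.1).differentiableAt hn).hasDerivAt
    have h1 := (hasDerivAt_neg x).cpow_const (c := c - 1) hs
    have h2 := ((hasDerivAt_id' x).const_sub 1).cpow_const (c := a + b + 1 - c) hs1
    have hw := (p1.mul q2).sub (q1.mul p2)
    refine (hw.mul (h1.mul h2)).congr_deriv ?_
    rw [cpow_sub _ 1 (neg_ne_zero.2 hx0), cpow_sub _ 1 hx1, cpow_one, cpow_one]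
    have ep := hp.2 x hx
    have eq := hq.2 x hx
    change x * deriv (euler p) x + (c - 1) * euler p x =
      x * (x * deriv (euler p) x + (a + b) * euler p x + a * b * p x) at ep
    change x * deriv (euler q) x + (c - 1) * euler q x =
      x * (x * deriv (euler q) x + (a + b) * euler q x + a * b * q x) at eq
    have ep' : deriv p x = euler p x / x := by rw [euler]; field_simp
    have eq' : deriv q x = euler q x / x := by rw [euler]; field_simp
    have ep'' : deriv (euler p) x = ((x * (a + b) - (c - 1)) * euler p x + x * a * b * p x) /
        (x * (1 - x)) := by
      rw [eq_div_iff (mul_ne_zero hx0 hx1)]; linear_combination ep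
    have eq'' : deriv (euler q) x = ((x * (a + b) - (c - 1)) * euler q x + x * a * b * q x) /
        (x * (1 - x)) := by
      rw [eq_div_iff (mul_ne_zero hx0 hx1)]; linear_combination eq
    simp only [Pi.mul_apply, Pi.sub_apply]
    rw [ep'', eq'', ep', eq']
    field_simp
    ring
  obtain ⟨K, hK⟩ := ho.exists_is_const_of_deriv_eq_zero (convex_halfPlane _).isPreconnected
    (fun x hx => (hder x hx).differentiableAt.differentiableWithinAt) (fun x hx => (hder x hx).deriv)
  exact ⟨K, fun x hx => hK x hx⟩

lemma tendsto_pser_inv {t : ℕ → ℂ} (ht : Subexp t) :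
    Tendsto (fun u : ℝ => pser t (-(u : ℂ))⁻¹) atTop (𝓝 (t 0)) := by
  have h1 : ContinuousAt (pser t) 0 := (differentiableAt_pser ht (by simp)).continuousAt
  have h2 : Tendsto (fun u : ℝ => (-(u : ℂ))⁻¹) atTop (𝓝 0) := by
    have : Tendsto (fun u : ℝ => (((-u)⁻¹ : ℝ) : ℂ)) atTop (𝓝 ((0 : ℝ) : ℂ)) :=
      (continuous_ofReal.tendsto 0).comp (tendsto_inv_atBot_zero.comp tendsto_neg_atTop_atBot)
    simpa using this
  have := h1.tendsto.comp h2
  rwa [pser_zero] at this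

lemma tendsto_one_add_div_cpow (s : ℂ) :
    Tendsto (fun u : ℝ => (1 + (u : ℂ)) ^ s * (u : ℂ) ^ (-s)) atTop (𝓝 1) := by
  have h1 : Tendsto (fun u : ℝ => (((1 + u⁻¹ : ℝ)) : ℂ) ^ s) atTop (𝓝 1) := by
    have h2 : Tendsto (fun u : ℝ => ((1 + u⁻¹ : ℝ) : ℂ)) atTop (𝓝 ((1 : ℝ) : ℂ)) := by
      refine (continuous_ofReal.tendsto 1).comp ?_
      simpa using tendsto_inv_atTop_zero.const_add (1 : ℝ)
    have h3 : ContinuousAt (fun z : ℂ => z ^ s) 1 :=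
      continuousAt_cpow_const (by simp)
    have := h3.tendsto
    rw [one_cpow] at this
    exact this.comp (by simpa using h2)
  refine h1.congr' ?_
  filter_upwards [eventually_gt_atTop 0] with u hu
  have hu' : (u : ℂ) ≠ 0 := by exact_mod_cast hu.ne'
  have : (1 + (u : ℂ)) = ((1 + u⁻¹ : ℝ) : ℂ) * (u : ℂ) := by
    push_cast; field_simp; ring
  rw [this, mul_cpow_ofReal_nonneg (by positivity) hu.le, mul_assoc, ← cpow_add _ _ hu']
  simp

/-- The Wronskian of the two solutions at infinity. -/
lemma wr_gc {a b : ℂ} (c : ℂ) (hab : ∀ n : ℤ, a - b ≠ n) {x : ℂ} (hx : x.re < -1) :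
    wr (gc a b c) (gc b a c) x ≠ 0 := by
  have hba : ∀ n : ℤ, b - a ≠ n := fun n h => hab (-n) (by push_cast; linear_combination -h)
  obtain ⟨K, hK⟩ := exists_wr_eq (isSol_gc c hab) (isSol_gc c hba).symm
  set t := hco a (1 - c + a) (1 - b + a) with ht'
  set t' := hco b (1 - c + b) (1 - a + b) with ht''
  have ht : Subexp t := subexp_hco a (1 - c + a) (1 - b + a)
  have htt : Subexp t' := subexp_hco b (1 - c + b) (1 - a + b)
  have l1 := ((tendsto_pser_inv ht).mul (tendsto_pser_inv (htt.lower b))).sub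
    ((tendsto_pser_inv htt).mul (tendsto_pser_inv (ht.lower a)))
  have l2 := l1.mul (tendsto_one_add_div_cpow (a + b + 1 - c))
  have l3 : Tendsto (fun _ : ℝ => K) atTop (𝓝 (a - b)) := by
    have e : (t 0 * lower b t' 0 - t' 0 * lower a t 0) * 1 = a - b := by
      simp [lower, ht', ht'', hco_zero]
      ring
    rw [← e]
    refine l2.congr' ?_
    filter_upwards [eventually_gt_atTop 1] with u hu
    have hu0 : (u : ℂ) ≠ 0 := by
      have : u ≠ 0 := by linarith
      exact_mod_cast this
    have hu1 : (-(u : ℂ)).re < -1 := by simpa using hu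
    rw [← hK (-(u : ℂ)) hu1, wr, gc, gc, euler_gser ht a hu1, euler_gser htt b hu1]
    simp only [gser, neg_neg, sub_neg_eq_add]
    have e1 : (u : ℂ) ^ (-(a + b + 1 - c)) = (u : ℂ) ^ (-a) * (u : ℂ) ^ (-b) * (u : ℂ) ^ (c - 1) := by
      rw [← cpow_add _ _ hu0, ← cpow_add _ _ hu0]; congr 1; ring
    rw [e1]
    ring
  have hKab : K = a - b := tendsto_nhds_unique tendsto_const_nhds l3
  intro h0
  have := hK x hx
  rw [h0, zero_mul, hKab] at this
  exact hab 0 (by simpa using this.symm)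

/-! ### The connection formula for the Gauss function -/

/-- `A` and `B` are the connection coefficients between the origin and infinity. -/
def IsConn (a b c A B : ℂ) : Prop :=
  ∀ x : ℂ, x.re < -1 → fc a b c x = A * gc a b c x + B * gc b a c x

lemma neg_int_ne {a b : ℂ} (hab : ∀ n : ℤ, a - b ≠ n) (n : ℤ) : b - a ≠ n := fun h =>
  hab (-n) (by push_cast; linear_combination -h)

lemma IsConn.symm {a b c A B : ℂ} (hc : ∀ n : ℕ, c ≠ -n) (h : IsConn a b c A B) :
    IsConn b a c B A := fun x hx => by
  rw [← fc_comm a b hc (by linarith), h x hx, add_comm]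

lemma exists_isConn {a b c : ℂ} (hc : ∀ n : ℕ, c ≠ -n) (hab : ∀ n : ℤ, a - b ≠ n) :
    ∃ A B, IsConn a b c A B := by
  have s1 := isSol_gc c hab
  have s2 := (isSol_gc c (neg_int_ne hab)).symm
  have s0 := isSol_fc a b hc
  obtain ⟨K, hK⟩ := exists_wr_eq s1 s2
  obtain ⟨K1, hK1⟩ := exists_wr_eq s0 s2
  obtain ⟨K2, hK2⟩ := exists_wr_eq s1 s0
  refine ⟨K1 / K, K2 / K, fun x hx => ?_⟩
  have hx0 : -x ≠ 0 := by
    rw [neg_ne_zero]; rintro rfl; norm_num at hx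
  have hx1 : 1 - x ≠ 0 := slitPlane_ne_zero (one_sub_mem_slitPlane (by linarith))
  have hw := wr_gc c hab hx
  have hφ : (-x) ^ (c - 1) * (1 - x) ^ (a + b + 1 - c) ≠ 0 :=
    mul_ne_zero (by simp [cpow_eq_zero_iff, hx0]) (by simp [cpow_eq_zero_iff, hx1])
  rw [← hK x hx, ← hK1 x hx, ← hK2 x hx, mul_div_mul_right _ _ hφ, mul_div_mul_right _ _ hφ]
  field_simp
  simp only [wr]
  ring

lemma euler_linear {f p q : ℂ → ℂ} {A B : ℂ} (hp : DifferentiableOn ℂ p {x | x.re < -1})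
    (hq : DifferentiableOn ℂ q {x | x.re < -1})
    (h : ∀ x : ℂ, x.re < -1 → f x = A * p x + B * q x) {x : ℂ} (hx : x.re < -1) :
    euler f x = A * euler p x + B * euler q x := by
  have hn := (isOpen_halfPlane (-1)).mem_nhds hx
  have h1 : f =ᶠ[𝓝 x] fun x => A * p x + B * q x := by
    filter_upwards [hn] with y hy using h y hy
  have p1 := (hp.differentiableAt hn).hasDerivAt
  have q1 := (hq.differentiableAt hn).hasDerivAt
  have h2 : HasDerivAt (fun x => A * p x + B * q x) (A * deriv p x + B * deriv q x) x :=
    (p1.const_mul A).add (q1.const_mul B)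
  rw [(euler_eventuallyEq h1).eq_of_nhds, euler, h2.deriv]
  simp only [euler]
  ring

lemma differentiableOn_gc (a b c : ℂ) : DifferentiableOn ℂ (gc a b c) {x | x.re < -1} :=
  differentiableOn_gser (subexp_hco _ _ _) a

lemma coeff_unique {a b c A B A' B' : ℂ} (hab : ∀ n : ℤ, a - b ≠ n)
    (h : ∀ x : ℂ, x.re < -1 →
      A * gc a b c x + B * gc b a c x = A' * gc a b c x + B' * gc b a c x) : A = A' := by
  have h0 : ∀ x : ℂ, x.re < -1 → (fun _ => (0 : ℂ)) x =
      (A - A') * gc a b c x + (B - B') * gc b a c x := fun x hx => by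
    linear_combination -h x hx
  have hx : (-2 : ℂ).re < -1 := by norm_num
  have h1 := euler_linear (differentiableOn_gc a b c) (differentiableOn_gc b a c) h0 hx
  have h2 := h0 _ hx
  have h3 : euler (fun _ => (0 : ℂ)) (-2) = 0 := by simp [euler]
  rw [h3] at h1
  have h4 : (A - A') * wr (gc a b c) (gc b a c) (-2) = 0 := by
    simp only [wr]
    linear_combination (gc b a c (-2)) * h1 - (euler (gc b a c) (-2)) * h2
  exact sub_eq_zero.1 ((mul_eq_zero.1 h4).resolve_right (wr_gc c hab hx))

lemma gser_lower_add {t t' : ℕ → ℂ} (ht : Subexp t) (s c d : ℂ)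
    (h : ∀ k, lower s t k + c * t k = d * t' k) {x : ℂ} (hx : x.re < -1) :
    euler (gser s t) x + c * gser s t x = d * gser s t' x := by
  have hz := norm_inv_lt_one hx
  have h1 := pser_add (ht.lower s) ((subexp_const c).mul ht) hz
  rw [pser_const_mul, show (fun n => lower s t n + c * t n) = fun n => d * t' n from funext h,
    pser_const_mul] at h1
  rw [euler_gser ht s hx]
  simp only [gser]
  linear_combination (-(-x) ^ (-s)) * h1

lemma gc_raise_c (a b c : ℂ) {x : ℂ} (hx : x.re < -1) :
    euler (gc a b (c + 1)) x + c * gc a b (c + 1) x = (c - a) * gc a b c x := by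
  refine gser_lower_add (subexp_hco _ _ _) _ _ _ (fun k => ?_) hx
  have h := hco_raise_b a (a - c) (1 - b + a) k
  rw [show 1 - (c + 1) + a = a - c by ring, show 1 - c + a = a - c + 1 by ring, lower]
  linear_combination -h

lemma gc_raise_b {a b : ℂ} (c : ℂ) (hab : ∀ n : ℤ, a - b ≠ n) {x : ℂ} (hx : x.re < -1) :
    euler (gc a b c) x + b * gc a b c x = (b - a) * gc a (b + 1) c x := by
  refine gser_lower_add (subexp_hco _ _ _) _ _ _ (fun k => ?_) hx
  have h := hco_raise_c a (1 - c + a) (c := a - b)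
    (fun n h => hab (-n) (by push_cast; exact h)) k
  rw [show 1 - (b + 1) + a = a - b by ring, show 1 - b + a = a - b + 1 by ring, lower]
  linear_combination -h

lemma hco_succ_shift (a b c : ℂ) (k : ℕ) :
    (k + 1) * hco a b c (k + 1) = a * b / c * hco (a + 1) (b + 1) (c + 1) k := by
  have h5 : (k + 1 : ℂ) ≠ 0 := by exact_mod_cast k.succ_ne_zero
  have h6 : (k + 1 : ℂ) * ((k + 1 : ℂ))⁻¹ = 1 := mul_inv_cancel₀ h5
  simp only [hco, poch_succ_left, Nat.factorial_succ, div_eq_mul_inv, mul_inv]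
  push_cast
  rw [mul_inv]
  linear_combination (a * poch (a + 1) k * (b * poch (b + 1) k) * (c⁻¹ * (poch (c + 1) k)⁻¹ *
    ((k.factorial : ℂ))⁻¹)) * h6

lemma gc_raise_exponent (a b c : ℂ) {x : ℂ} (hx : x.re < -1) :
    euler (gc b a c) x + b * gc b a c x =
      (b * (1 - c + b) / (1 - a + b)) * gc (b + 1) a c x := by
  have ht := subexp_hco b (1 - c + b) (1 - a + b)
  have hz := norm_inv_lt_one hx
  have hx0 : x ≠ 0 := by rintro rfl; norm_num at hx
  rw [gc, gc, euler_gser ht b hx]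
  simp only [gser]
  rw [pser_lower ht b hz, pser_shift (subexp_natCast.mul ht) (by simp) hz]
  have : (fun n : ℕ => ((n + 1 : ℕ) : ℂ) * hco b (1 - c + b) (1 - a + b) (n + 1)) = fun n =>
      (b * (1 - c + b) / (1 - a + b)) * hco (b + 1) (1 - c + (b + 1)) (1 - a + (b + 1)) n := by
    ext n
    have := hco_succ_shift b (1 - c + b) (1 - a + b) n
    push_cast
    rw [this, add_assoc, add_assoc]
  rw [this, pser_const_mul, neg_add, cpow_add _ _ (neg_ne_zero.2 hx0), cpow_neg_one, inv_neg]
  ring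

lemma IsConn.raise_b {a b c A B A' B' : ℂ} (hc : ∀ n : ℕ, c ≠ -n) (hab : ∀ n : ℤ, a - b ≠ n)
    (h : IsConn a b c A B) (h' : IsConn a (b + 1) c A' B') : (b - a) * A = b * A' := by
  have hab' : ∀ n : ℤ, a - (b + 1) ≠ n := fun n h =>
    hab (n + 1) (by push_cast; linear_combination h)
  refine coeff_unique (B := B * (b * (1 - c + b) / (1 - a + b))) (B' := b * B') (c := c) hab'
    fun x hx => ?_
  have h1 := euler_linear (differentiableOn_gc a b c) (differentiableOn_gc b a c) h hx
  have h2 := fc_raise_b a b hc (x := x) (by linarith)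
  rw [h1, h x hx, h' x hx] at h2
  linear_combination h2 - A * gc_raise_b c hab hx - B * gc_raise_exponent a b c hx

lemma IsConn.raise_c {a b c A B A' B' : ℂ} (hc : ∀ n : ℕ, c ≠ -n) (hab : ∀ n : ℤ, a - b ≠ n)
    (h : IsConn a b c A B) (h' : IsConn a b (c + 1) A' B') : c * A = (c - a) * A' := by
  refine coeff_unique (B := c * B) (B' := (c - b) * B') (c := c) hab fun x hx => ?_
  have h1 := euler_linear (differentiableOn_gc a b (c + 1)) (differentiableOn_gc b a (c + 1)) h' hx
  have h2 := fc_raise_c a b hc (x := x) (by linarith)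
  rw [h1, h x hx, h' x hx] at h2
  linear_combination -h2 + A' * gc_raise_c a b c hx + B' * gc_raise_c b a c hx

/-- When the exponent `a` dominates, its coefficient is a limit at infinity. -/
lemma IsConn.tendsto {a b c A B : ℂ} (h : IsConn a b c A B) (hre : a.re < b.re) :
    Tendsto (fun u : ℝ => pser (hco a (c - b) c) ((u / (1 + u) : ℝ) : ℂ)) atTop (𝓝 A) := by
  have l1 := (tendsto_pser_inv (subexp_hco a (1 - c + a) (1 - b + a))).const_mul A
  have l2 := (tendsto_pser_inv (subexp_hco b (1 - c + b) (1 - a + b))).const_mul B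
  have l3 : Tendsto (fun u : ℝ => (u : ℂ) ^ (a - b)) atTop (𝓝 0) := by
    rw [tendsto_zero_iff_norm_tendsto_zero]
    have := tendsto_rpow_neg_atTop (y := b.re - a.re) (by linarith)
    refine this.congr' ?_
    filter_upwards [eventually_gt_atTop 0] with u hu
    rw [norm_cpow_eq_rpow_re_of_pos hu]
    simp
  have l4 := (l1.add (l3.mul l2)).mul (tendsto_one_add_div_cpow a)
  rw [hco_zero, hco_zero, zero_mul, mul_one, mul_one, add_zero] at l4
  refine l4.congr' ?_
  filter_upwards [eventually_gt_atTop 1] with u hu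
  have hu1 : (-(u : ℂ)).re < -1 := by simpa using hu
  have hu0 : (u : ℂ) ≠ 0 := by
    have : u ≠ 0 := by linarith
    exact_mod_cast this
  have hu2 : 1 + (u : ℂ) ≠ 0 := by
    have : 1 + u ≠ 0 := by linarith
    exact_mod_cast this
  have h0 := h _ hu1
  simp only [fc, gc, gser, neg_neg, sub_neg_eq_add] at h0
  have e1 : -(u : ℂ) / (-(u : ℂ) - 1) = ((u / (1 + u) : ℝ) : ℂ) := by
    push_cast
    rw [← neg_div_neg_eq]
    congr 1 <;> ring
  rw [e1] at h0
  have e2 : (1 + (u : ℂ)) ^ (-a) * (1 + (u : ℂ)) ^ a = 1 := by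
    rw [← cpow_add _ _ hu2]; simp
  have e3 : (u : ℂ) ^ (-a) * (u : ℂ) ^ a = 1 := by
    rw [← cpow_add _ _ hu0]; simp
  have e4 : (u : ℂ) ^ (a - b) = (u : ℂ) ^ a * (u : ℂ) ^ (-b) := by
    rw [← cpow_add _ _ hu0, sub_eq_add_neg]
  rw [e4]
  linear_combination (-(1 + (u : ℂ)) ^ a) * h0 +
    pser (hco a (c - b) c) ((u / (1 + u) : ℝ) : ℂ) * e2 + ((u : ℂ) ^ (-b) * B *
      pser (hco b (1 - c + b) (1 - a + b)) (-(u : ℂ))⁻¹ * (1 + (u : ℂ)) ^ a) * e3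

/-! ### Values of the connection coefficients -/

lemma norm_hco_succ_le {a b c : ℂ} {P M : ℝ} (hP : 0 ≤ P) (ha : ‖a‖ ≤ P) (hb : ‖b‖ ≤ P)
    (hM : 3 * (P + 1) ^ 2 ≤ M) (hc : ∀ j : ℕ, M + j ≤ ‖c + j‖) (k : ℕ) :
    ‖hco a b c (k + 1)‖ ≤ 2 * P ^ 2 / M * (1 / (((k : ℝ) + 1) * (k + 2))) := by
  have hM0 : 0 < M := by nlinarith
  have hc0 : ∀ n : ℕ, c ≠ -n := fun n h => by
    have := hc n
    rw [h, neg_add_cancel, norm_zero] at this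
    have h2 : (0 : ℝ) ≤ n := n.cast_nonneg
    linarith
  have hstep : ∀ k : ℕ, ((k : ℝ) + 1) * (M + k) * ‖hco a b c (k + 1)‖ ≤
      (P + k) ^ 2 * ‖hco a b c k‖ := fun k => by
    have h1 := congrArg norm (hco_succ a b hc0 k)
    simp only [norm_mul] at h1
    have h2 : ‖(k : ℂ) + 1‖ = k + 1 := by
      rw [← Nat.cast_succ, norm_natCast, Nat.cast_succ]
    have h3 : ‖a + k‖ ≤ P + k := (norm_add_le _ _).trans (by simpa using ha)
    have h4 : ‖b + k‖ ≤ P + k := (norm_add_le _ _).trans (by simpa using hb)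
    rw [h2] at h1
    calc ((k : ℝ) + 1) * (M + k) * ‖hco a b c (k + 1)‖
        ≤ ((k : ℝ) + 1) * ‖c + k‖ * ‖hco a b c (k + 1)‖ := by gcongr; exact hc k
      _ = ‖a + k‖ * ‖b + k‖ * ‖hco a b c k‖ := h1
      _ ≤ (P + k) * (P + k) * ‖hco a b c k‖ := by gcongr
      _ = _ := by ring
  induction k with
  | zero =>
    have := hstep 0
    rw [hco_zero] at this
    simp only [Nat.cast_zero, zero_add, add_zero, one_mul, norm_one, mul_one] at this ⊢
    have h2 : ‖hco a b c 1‖ ≤ P ^ 2 / M := by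
      rw [le_div_iff₀ hM0]; linarith
    calc _ ≤ _ := h2
      _ = _ := by ring
  | succ k ih =>
    have h1 := hstep (k + 1)
    push_cast at h1 ⊢
    have hk : (0 : ℝ) ≤ k := k.cast_nonneg
    have h2 : (P + (k + 1)) ^ 2 * ((k : ℝ) + 3) ≤ (M + (k + 1)) * (k + 1) * (k + 2) := by
      have e : 3 * (P + 1) ^ 2 * (((k : ℝ) + 1) * (k + 2)) ≤ M * ((k + 1) * (k + 2)) := by gcongr
      have : (0 : ℝ) ≤ P * k := by positivity
      have : (0 : ℝ) ≤ P * k ^ 2 := by positivity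
      have : (0 : ℝ) ≤ P ^ 2 * k := by positivity
      have : (0 : ℝ) ≤ P ^ 2 * k ^ 2 := by positivity
      have : (0 : ℝ) ≤ P ^ 2 := by positivity
      nlinarith
    set K := 2 * P ^ 2 / M with hK
    have hK0 : 0 ≤ K := by positivity
    clear_value K
    have h3 : ((k : ℝ) + 1 + 1) * (M + (k + 1)) * ‖hco a b c (k + 1 + 1)‖ ≤
        (P + (k + 1)) ^ 2 * (K * (1 / (((k : ℝ) + 1) * (k + 2)))) :=
      h1.trans (by gcongr)
    have h4 : (P + (k + 1)) ^ 2 * (K * (1 / (((k : ℝ) + 1) * (k + 2)))) ≤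
        ((k : ℝ) + 1 + 1) * (M + (k + 1)) * (K * (1 / (((k : ℝ) + 1 + 1) * (k + 1 + 2)))) := by
      rw [mul_one_div, mul_one_div, mul_div_assoc', mul_div_assoc',
        div_le_div_iff₀ (by positivity) (by positivity)]
      have := mul_le_mul_of_nonneg_left h2 (by positivity : 0 ≤ K * ((k : ℝ) + 1 + 1))
      linarith
    exact le_of_mul_le_mul_left (h3.trans h4) (by positivity)

lemma summable_one_div_mul : Summable fun k : ℕ => 1 / (((k : ℝ) + 1) * (k + 2)) := by
  refine Summable.of_nonneg_of_le (fun k => by positivity) (fun k => ?_)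
    ((summable_nat_add_iff 1).2 (Real.summable_one_div_nat_pow.2 one_lt_two))
  push_cast
  rw [pow_two]
  gcongr
  linarith

lemma norm_pser_hco_sub_one_le {a b c : ℂ} {P M : ℝ} (hP : 0 ≤ P) (ha : ‖a‖ ≤ P) (hb : ‖b‖ ≤ P)
    (hM : 3 * (P + 1) ^ 2 ≤ M) (hc : ∀ j : ℕ, M + j ≤ ‖c + j‖) {z : ℂ} (hz : ‖z‖ < 1) :
    ‖pser (hco a b c) z - 1‖ ≤ 2 * P ^ 2 / M * ∑' k : ℕ, 1 / (((k : ℝ) + 1) * (k + 2)) := by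
  rw [pser, (summable_pser (subexp_hco a b c) hz).tsum_eq_zero_add, hco_zero, pow_zero, mul_one,
    add_sub_cancel_left]
  refine tsum_of_norm_bounded (summable_one_div_mul.hasSum.mul_left _) fun k => ?_
  rw [norm_mul, norm_pow]
  exact (mul_le_of_le_one_right (norm_nonneg _) (pow_le_one₀ (norm_nonneg _) hz.le)).trans
    (norm_hco_succ_le hP ha hb hM hc k)

lemma tendsto_connection_coeff {a b c : ℂ} {A B : ℕ → ℂ}
    (h : ∀ n : ℕ, IsConn a (b + n) (c + n) (A n) (B n)) : Tendsto A atTop (𝓝 1) := by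
  set P := max ‖a‖ ‖c - b‖ with hPdef
  have hP : 0 ≤ P := (norm_nonneg a).trans (le_max_left _ _)
  have hn : Tendsto (fun n : ℕ => (n : ℝ) - ‖c‖) atTop atTop :=
    tendsto_atTop_add_const_right _ _ tendsto_natCast_atTop_atTop
  have hre : Tendsto (fun n : ℕ => b.re + n) atTop atTop :=
    tendsto_atTop_add_const_left _ _ tendsto_natCast_atTop_atTop
  rw [tendsto_iff_norm_sub_tendsto_zero]
  have l0 := (hn.const_div_atTop (2 * P ^ 2)).mul_const (∑' k : ℕ, 1 / (((k : ℝ) + 1) * (k + 2)))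
  rw [zero_mul] at l0
  refine squeeze_zero' (Eventually.of_forall fun _ => norm_nonneg _) ?_ l0
  filter_upwards [hn.eventually_ge_atTop (3 * (P + 1) ^ 2), hre.eventually_gt_atTop a.re]
    with n h1 h2
  have h3 := (h n).tendsto (by simpa using h2)
  refine le_of_tendsto (h3.sub_const 1).norm ?_
  filter_upwards [eventually_gt_atTop 0] with u hu
  refine norm_pser_hco_sub_one_le hP (le_max_left _ _) ?_ h1 (fun j => ?_) ?_
  · rw [add_sub_add_right_eq_sub]
    exact le_max_right _ _
  · have := norm_sub_norm_le ((n : ℂ) + j) (-c)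
    rw [sub_neg_eq_add, norm_neg, ← Nat.cast_add, norm_natCast, Nat.cast_add] at this
    rw [show c + n + j = ((n + j : ℕ) : ℂ) + c by push_cast; ring]
    linarith
  · rw [norm_real, Real.norm_of_nonneg (by positivity), div_lt_one (by positivity)]
    linarith

lemma connection_coeff_shift {a b c : ℂ} (hc : ∀ n : ℕ, c ≠ -n) (hab : ∀ n : ℤ, a - b ≠ n)
    {A B : ℕ → ℂ} (h : ∀ n : ℕ, IsConn a (b + n) (c + n) (A n) (B n)) (n : ℕ) :
    A 0 * poch (b - a) n * poch c n = poch b n * poch (c - a) n * A n := by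
  induction n with
  | zero => simp [poch_zero]
  | succ n ih =>
    have hc' : ∀ m : ℕ, c + n ≠ -m := fun m hm =>
      hc (m + n) (by push_cast; linear_combination hm)
    have hab' : ∀ m : ℤ, a - (b + n) ≠ m := fun m hm =>
      hab (m + n) (by push_cast; linear_combination hm)
    have hab'' : ∀ m : ℤ, a - (b + n + 1) ≠ m := fun m hm =>
      hab (m + n + 1) (by push_cast; linear_combination hm)
    obtain ⟨A', B', h'⟩ := exists_isConn (a := a) (b := b + n + 1) hc' hab''
    have h1 := (h n).raise_b hc' hab' h'
    have hs := h (n + 1)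
    push_cast at hs
    rw [← add_assoc, ← add_assoc] at hs
    have h2 := h'.raise_c hc' hab'' hs
    simp only [poch_succ]
    linear_combination ((b - a + n) * (c + n)) * ih + poch b n * poch (c - a) n * (c + n) * h1
      + poch b n * poch (c - a) n * (b + n) * h2

lemma tendsto_poch_div_Gamma (s : ℂ) :
    Tendsto (fun n : ℕ => poch s (n + 1) / ((n : ℂ) ^ s * (n.factorial : ℂ))) atTop
      (𝓝 (Gamma s)⁻¹) := by
  by_cases hs : Gamma s = 0
  · rw [hs, inv_zero]
    obtain ⟨m, rfl⟩ := (Gamma_eq_zero_iff s).1 hs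
    refine tendsto_const_nhds.congr' ?_
    filter_upwards [eventually_ge_atTop m] with n hn
    rw [poch_eq_prod, Finset.prod_eq_zero (Finset.mem_range.2 (Nat.lt_succ_of_le hn)) (by simp),
      zero_div]
  · refine ((GammaSeq_tendsto_Gamma s).inv₀ hs).congr fun n => ?_
    rw [GammaSeq, inv_div, poch_eq_prod]

/-- The value of a connection coefficient. -/
lemma IsConn.eq_Gamma {a b c A B : ℂ} (hc : ∀ n : ℕ, c ≠ -n) (hab : ∀ n : ℤ, a - b ≠ n)
    (h : IsConn a b c A B) : A = Gamma c * Gamma (b - a) / (Gamma b * Gamma (c - a)) := by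
  have hc' (n : ℕ) : ∀ m : ℕ, c + n ≠ -m := fun m hm =>
    hc (m + n) (by push_cast; linear_combination hm)
  have hab' (n : ℕ) : ∀ m : ℤ, a - (b + n) ≠ m := fun m hm =>
    hab (m + n) (by push_cast; linear_combination hm)
  choose A' B' h' using fun n : ℕ => exists_isConn (hc' n) (hab' n)
  have h0 : A = A' 0 := by
    refine coeff_unique (B := B) (B' := B' 0) (c := c) hab fun x hx => ?_
    have := h' 0 x hx
    simp only [Nat.cast_zero, add_zero] at this
    rw [← h x hx, this]
  have l1 := ((tendsto_poch_div_Gamma (b - a)).mul (tendsto_poch_div_Gamma c)).const_mul A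
  have l2 := ((tendsto_poch_div_Gamma b).mul (tendsto_poch_div_Gamma (c - a))).mul
    ((tendsto_connection_coeff h').comp (tendsto_add_atTop_nat 1))
  have h3 := tendsto_nhds_unique (l1.congr' ?_) l2
  · have g1 : Gamma (b - a) ≠ 0 := fun h => by
      obtain ⟨m, hm⟩ := (Gamma_eq_zero_iff _).1 h
      exact hab m (by push_cast; linear_combination -hm)
    have g2 : Gamma c ≠ 0 := fun h => by
      obtain ⟨m, hm⟩ := (Gamma_eq_zero_iff _).1 h
      exact hc m hm
    rw [mul_one] at h3
    field_simp at h3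
    rw [h3, div_eq_mul_inv, mul_inv]
    ring
  · filter_upwards [eventually_ge_atTop 1] with n hn
    have h4 := connection_coeff_shift hc hab h' (n + 1)
    have hn0 : (n : ℂ) ≠ 0 := by exact_mod_cast (by omega : n ≠ 0)
    have e : (n : ℂ) ^ (b - a) * (n : ℂ) ^ c = (n : ℂ) ^ b * (n : ℂ) ^ (c - a) := by
      rw [← cpow_add _ _ hn0, ← cpow_add _ _ hn0]
      congr 1; ring
    have e2 : A * (poch (b - a) (n + 1) / ((n : ℂ) ^ (b - a) * n.factorial) *
        (poch c (n + 1) / ((n : ℂ) ^ c * n.factorial))) = (A * poch (b - a) (n + 1) *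
        poch c (n + 1)) / (((n : ℂ) ^ (b - a) * (n : ℂ) ^ c) * n.factorial ^ 2) := by
      rw [div_mul_div_comm, mul_div_assoc']
      congr 1 <;> ring
    rw [e2, h0, h4, e, Function.comp, div_mul_div_comm, div_mul_eq_mul_div]
    congr 1
    ring

/-- The Gauss connection formula between the origin and infinity. -/
lemma connection_formula {a b c : ℂ} (hc : ∀ n : ℕ, c ≠ -n) (hab : ∀ n : ℤ, a - b ≠ n) {x : ℂ}
    (hx : x.re < -1) :
    fc a b c x = Gamma c * Gamma (b - a) / (Gamma b * Gamma (c - a)) * gc a b c x +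
      Gamma c * Gamma (a - b) / (Gamma a * Gamma (c - b)) * gc b a c x := by
  obtain ⟨A, B, h⟩ := exists_isConn hc hab
  rw [← h.eq_Gamma hc hab, ← (h.symm hc).eq_Gamma hc (neg_int_ne hab)]
  exact h x hx

/-! ### The double series and its continuation to a half plane -/

/-- The general term of the Humbert double series. -/
noncomputable def humbertTerm (a b c c' X Y : ℂ) (p : ℕ × ℕ) : ℂ :=
  poch a (p.1 + p.2) * poch b p.1 / (poch c p.1 * poch c' p.2) * X ^ p.1 * Y ^ p.2 /
    ((Nat.factorial p.1 : ℂ) * (Nat.factorial p.2 : ℂ))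

/-- The coefficient of the `n`-th Gauss function in the Humbert series. -/
noncomputable def gaussWeight (a c' y : ℂ) (n : ℕ) : ℂ :=
  poch a n * y ^ n / (poch c' n * (n.factorial : ℂ))

lemma exists_bound_inv_poch (c' : ℂ) :
    ∃ C : ℝ, 0 ≤ C ∧ ∀ n, ‖(poch c' n)⁻¹‖ ≤ C * (2 ^ n / n.factorial) := by
  obtain ⟨C, hC, h⟩ := subexp_poch_div 1 c' 2 one_lt_two
  refine ⟨C, hC, fun n => ?_⟩
  have h1 : ‖poch 1 n / poch c' n‖ ≤ C * 2 ^ n := h n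
  have h2 : (0 : ℝ) < n.factorial := by exact_mod_cast n.factorial_pos
  rw [poch_one, div_eq_mul_inv, norm_mul, norm_natCast] at h1
  rw [mul_div_assoc', le_div_iff₀ h2]
  linarith

lemma exists_summable_bound_humbertTerm (a b c c' : ℂ) {r : ℝ} (hr : 0 ≤ r) (hr1 : r < 1)
    {R : ℝ} (hR : 0 ≤ R) :
    ∃ u : ℕ × ℕ → ℝ, Summable u ∧ ∀ X Y : ℂ, ‖X‖ ≤ r → ‖Y‖ ≤ R → ∀ p,
      ‖humbertTerm a b c c' X Y p‖ ≤ u p := by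
  set s := (1 - r) / 4 with hs
  have hs0 : 0 < s := by linarith
  obtain ⟨C1, hC1, h1⟩ := exists_bound_poch_add a hs0
  obtain ⟨C2, hC2, h2⟩ := subexp_poch_div b c (1 + s) (by linarith)
  obtain ⟨C3, hC3, h3⟩ := exists_bound_inv_poch c'
  set K := (1 + s) * (1 + 2 * s⁻¹) with hK
  have hK0 : 0 ≤ K := by positivity
  have hq : (1 + s) * (1 + s) * r < 1 := by
    rw [hs]; nlinarith [mul_nonneg hr (sub_pos.2 hr1).le]
  refine ⟨fun p => (C1 * C2 * C3) * (((1 + s) * (1 + s) * r) ^ p.1 *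
    ((2 * K * R) ^ p.2 / p.2.factorial)), ?_, fun X Y hX hY p => ?_⟩
  · refine Summable.mul_left _ ?_
    exact (summable_geometric_of_lt_one (by positivity) hq).mul_of_nonneg
      (Real.summable_pow_div_factorial (2 * K * R))
      (fun _ => by simp only [Pi.zero_apply]; positivity)
      (fun _ => by simp only [Pi.zero_apply]; positivity)
  · have e : humbertTerm a b c c' X Y p =
        poch a (p.1 + p.2) / ((p.1.factorial : ℂ) * (p.2.factorial : ℂ)) *
          (poch b p.1 / poch c p.1) * (poch c' p.2)⁻¹ * X ^ p.1 * Y ^ p.2 := by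
      simp only [humbertTerm, div_eq_mul_inv, mul_inv]
      ring
    rw [e, norm_mul, norm_mul, norm_mul, norm_mul, norm_pow, norm_pow]
    calc _ ≤ (C1 * (1 + s) ^ p.1 * K ^ p.2) * (C2 * (1 + s) ^ p.1) *
          (C3 * (2 ^ p.2 / p.2.factorial)) * r ^ p.1 * R ^ p.2 := by
          gcongr
          · exact h1 _ _
          · exact h2 _
          · exact h3 _
      _ = _ := by
          simp only [mul_pow]
          ring

lemma summable_humbertTerm (a b c c' : ℂ) {X : ℂ} (hX : ‖X‖ < 1) (Y : ℂ) :
    Summable (humbertTerm a b c c' X Y) := by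
  obtain ⟨u, hu, h⟩ := exists_summable_bound_humbertTerm a b c c' (norm_nonneg X) hX (norm_nonneg Y)
  exact Summable.of_norm_bounded hu (h X Y le_rfl le_rfl)

lemma tsum_humbertTerm (a b c c' : ℂ) {X : ℂ} (hX : ‖X‖ < 1) (Y : ℂ) :
    ∑' p, humbertTerm a b c c' X Y p = ∑' n, gaussWeight a c' Y n * pser (hco (a + n) b c) X := by
  have hs := summable_humbertTerm a b c c' hX Y
  rw [← (Equiv.prodComm ℕ ℕ).tsum_eq]
  refine ((Equiv.prodComm ℕ ℕ).summable_iff.2 hs).tsum_prod.trans ?_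
  congr 1; ext n
  rw [pser, ← tsum_mul_left]
  congr 1; ext m
  simp only [Function.comp_apply, Equiv.prodComm_apply, Prod.swap_prod_mk, humbertTerm,
    gaussWeight, hco]
  rw [add_comm m n, poch_add]
  simp only [div_eq_mul_inv, mul_inv]
  ring

lemma tsum_gaussWeight_mul_fc (a b c c' y : ℂ) {x : ℂ} (hx : x.re < 1 / 2) :
    (1 - x) ^ (-a) * ∑' p, humbertTerm a (c - b) c c' (x / (x - 1)) (y / (1 - x)) p =
      ∑' n, gaussWeight a c' y n * fc (a + n) b c x := by
  have hx1 : 1 - x ≠ 0 := slitPlane_ne_zero (one_sub_mem_slitPlane (by linarith))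
  rw [tsum_humbertTerm a _ c c' (norm_div_sub_one_lt hx), ← tsum_mul_left]
  congr 1; ext n
  rw [fc, gaussWeight, gaussWeight, neg_add, cpow_add _ _ hx1, cpow_neg _ (n : ℂ), cpow_natCast,
    div_pow]
  simp only [div_eq_mul_inv, mul_inv]
  ring

lemma differentiableOn_tsum_gaussWeight_mul_fc (a b c c' y : ℂ) :
    DifferentiableOn ℂ (fun x => ∑' n, gaussWeight a c' y n * fc (a + n) b c x)
      {x | x.re < 1 / 2} := by
  refine DifferentiableOn.congr (f := fun x => (1 - x) ^ (-a) *
    ∑' p, humbertTerm a (c - b) c c' (x / (x - 1)) (y / (1 - x)) p) ?_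
    fun x hx => (tsum_gaussWeight_mul_fc a b c c' y hx).symm
  intro x0 hx0
  have hU := isOpen_halfPlane (1 / 2)
  have d1 : ∀ x : ℂ, x.re < 1 / 2 → DifferentiableAt ℂ (fun x => x / (x - 1)) x := fun x hx =>
    differentiableAt_id.div (differentiableAt_id.sub_const 1) (sub_one_ne_zero (by linarith))
  have d2 : ∀ x : ℂ, x.re < 1 / 2 → DifferentiableAt ℂ (fun x => y / (1 - x)) x := fun x hx =>
    (differentiableAt_const y).div (differentiableAt_id.const_sub 1)
      (slitPlane_ne_zero (one_sub_mem_slitPlane (by linarith)))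
  obtain ⟨r, hr, hr1⟩ := exists_between (norm_div_sub_one_lt hx0)
  obtain ⟨R, hR⟩ := exists_gt ‖y / (1 - x0)‖
  have n1 := (d1 x0 hx0).continuousAt.norm.eventually_lt_const hr
  have n2 := (d2 x0 hx0).continuousAt.norm.eventually_lt_const hR
  obtain ⟨V, hV, hVo, hxV⟩ := mem_nhds_iff.1 ((n1.and n2).and (hU.mem_nhds hx0))
  obtain ⟨u, hu, hbd⟩ := exists_summable_bound_humbertTerm a (c - b) c c'
    ((norm_nonneg _).trans hr.le) hr1 ((norm_nonneg _).trans hR.le)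
  have hd := differentiableOn_tsum_of_summable_norm (F := fun p x =>
      humbertTerm a (c - b) c c' (x / (x - 1)) (y / (1 - x)) p) hu (fun p x hx => by
    have hx' : x.re < 1 / 2 := (hV hx).2
    have e1 := d1 x hx'
    have e2 := d2 x hx'
    refine DifferentiableAt.differentiableWithinAt ?_
    exact (((e1.pow p.1).const_mul _).mul (e2.pow p.2)).div_const _) hVo
    (fun p x hx => hbd _ _ (hV hx).1.1.le (hV hx).1.2.le p)
  refine DifferentiableAt.differentiableWithinAt ?_
  exact (((differentiableAt_id (x := x0)).const_sub 1).cpow_const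
    (one_sub_mem_slitPlane (by linarith [show (id x0).re < 1 / 2 from hx0]))).mul
    (hd.differentiableAt (hVo.mem_nhds hxV))

lemma eq_tsum_gaussWeight_mul_fc {a b c c' y : ℂ} (hc : ∀ n : ℕ, c ≠ -n) {Ψ : ℂ → ℂ}
    (hΨ : AnalyticOn ℂ Ψ {x : ℂ | x.im ≠ 0 ∨ x.re < 1})
    (hser : ∀ x : ℂ, ‖x‖ < 1 → Ψ x = ∑' p, humbertTerm a b c c' x y p) {x : ℂ}
    (hx : x.re < 1 / 2) : Ψ x = ∑' n, gaussWeight a c' y n * fc (a + n) b c x := by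
  refine eqOn_halfPlane (hΨ.differentiableOn.mono fun x (hx : x.re < 1 / 2) =>
    Or.inr (by linarith)) (differentiableOn_tsum_gaussWeight_mul_fc a b c c' y) ?_ hx
  filter_upwards [Metric.ball_mem_nhds (0 : ℂ) (ε := 1 / 16) (by norm_num)] with x hx
  rw [mem_ball_zero_iff] at hx
  have hx1 : ‖x‖ < 1 := by linarith
  rw [hser x hx1, tsum_humbertTerm a b c c' hx1]
  congr 1; ext n
  rw [fc, pfaff_of_norm_lt _ b hc hx]

/-! ### Rearrangement at infinity -/

lemma inv_Gamma_sub_natCast (s : ℂ) (n : ℕ) :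
    (Gamma (s - n))⁻¹ = (-1) ^ n * poch (1 - s) n * (Gamma s)⁻¹ := by
  induction n with
  | zero => simp [poch_zero]
  | succ n ih =>
    rw [one_div_Gamma_eq_self_mul_one_div_Gamma_add_one,
      show s - ((n + 1 : ℕ) : ℂ) + 1 = s - n by push_cast; ring, ih, poch_succ]
    push_cast
    ring

lemma inv_Gamma_eq_poch_mul (s : ℂ) (n : ℕ) :
    (Gamma s)⁻¹ = poch s n * (Gamma (s + n))⁻¹ := by
  induction n with
  | zero => simp [poch_zero]
  | succ n ih =>
    rw [ih, one_div_Gamma_eq_self_mul_one_div_Gamma_add_one, poch_succ]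
    push_cast
    rw [add_assoc s]
    ring

lemma poch_sub_natCast (s : ℂ) (n : ℕ) : poch (s - n) n = (-1) ^ n * poch (1 - s) n := by
  induction n generalizing s with
  | zero => simp [poch_zero]
  | succ n ih =>
    rw [poch_succ_left, show s - ((n + 1 : ℕ) : ℂ) + 1 = s - n by push_cast; ring, ih, poch_succ]
    push_cast
    ring

lemma poch_mul_poch_one_sub (s : ℂ) (n k : ℕ) :
    poch s n * poch (1 - s) k = poch (s - k) n * poch (1 - s - n) k := by
  have h1 := poch_add (s - k) k n
  have h2 := poch_add (s - k) n k
  have h3 := poch_sub_natCast s k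
  have h4 := poch_sub_natCast (s + n) k
  rw [sub_add_cancel, add_comm k n] at h1
  rw [show s - k + n = s + n - k by ring] at h2
  rw [show 1 - (s + n) = 1 - s - n by ring] at h4
  rw [h3] at h1
  rw [h4] at h2
  have h5 : ((-1 : ℂ) ^ k) * (-1) ^ k = 1 := by rw [← mul_pow]; simp
  linear_combination ((-1) ^ k) * (h2 - h1) +
    (poch (s - k) n * poch (1 - s - n) k - poch s n * poch (1 - s) k) * h5

lemma poch_neg_natCast_of_lt {k n : ℕ} (h : k < n) : poch (-(k : ℂ)) n = 0 := by
  rw [poch_eq_prod]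
  exact Finset.prod_eq_zero (Finset.mem_range.2 h) (by simp)

lemma poch_neg_natCast_add (n m : ℕ) :
    poch (-((m + n : ℕ) : ℂ)) n * m.factorial = (-1) ^ n * ((m + n).factorial : ℂ) := by
  have h1 := poch_add 1 m n
  have h2 := poch_sub_natCast (-(m : ℂ)) n
  rw [poch_one, poch_one] at h1
  rw [sub_neg_eq_add] at h2
  rw [show -((m + n : ℕ) : ℂ) = -m - n by push_cast; ring, h2, h1]
  ring

lemma norm_poch_le (s : ℂ) {q : ℕ} (h : ‖s‖ ≤ q) (n : ℕ) :
    ‖poch s n‖ ≤ n.factorial * ((q + n).choose n : ℝ) := by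
  have h1 : ‖poch s n‖ ≤ ∏ j ∈ Finset.range n, ((q : ℝ) + 1 + j) := by
    rw [poch_eq_prod, norm_prod]
    refine Finset.prod_le_prod (fun _ _ => norm_nonneg _) fun j _ => ?_
    refine (norm_add_le _ _).trans ?_
    rw [norm_natCast]
    linarith
  refine h1.trans_eq ?_
  rw [← Nat.cast_mul, ← Nat.ascFactorial_eq_factorial_mul_choose, Nat.ascFactorial_eq_prod_range]
  push_cast
  rfl

/-- The general term of the Kummer series. -/
noncomputable def kummerTerm (c' y s : ℂ) (n : ℕ) : ℂ :=
  poch s n / poch c' n * y ^ n / (n.factorial : ℂ)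

lemma exists_bound_kummerTerm (c' y s : ℂ) {ρ : ℝ} (hρ : 1 < ρ) :
    ∃ C L : ℝ, 0 ≤ C ∧ 0 ≤ L ∧ ∀ k n : ℕ,
      ‖kummerTerm c' y (s - k) n‖ ≤ C * ρ ^ k * (L ^ n / n.factorial) := by
  obtain ⟨C, hC, h⟩ := exists_bound_inv_poch c'
  obtain ⟨q, hq⟩ := exists_nat_ge ‖s‖
  obtain ⟨t, rfl⟩ : ∃ t, ρ = 1 + t := ⟨ρ - 1, by ring⟩
  have ht : 0 < t := by linarith
  refine ⟨C * (1 + t) ^ q, (1 + t) * t⁻¹ * 2 * ‖y‖, by positivity, by positivity, fun k n => ?_⟩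
  have h1 : ‖poch (s - k) n‖ ≤ n.factorial * ((1 + t) ^ (q + k + n) * t⁻¹ ^ n) := by
    refine (norm_poch_le (q := q + k) _ ?_ n).trans ?_
    · refine (norm_sub_le _ _).trans ?_
      rw [norm_natCast]
      push_cast
      linarith
    · gcongr
      exact choose_le_of_pos ht _ _
  have hn : (0 : ℝ) < n.factorial := by exact_mod_cast n.factorial_pos
  rw [kummerTerm, div_eq_mul_inv (poch _ _), norm_div, norm_mul, norm_mul, norm_pow, norm_natCast]
  calc _ ≤ (n.factorial * ((1 + t) ^ (q + k + n) * t⁻¹ ^ n)) * (C * (2 ^ n / n.factorial)) *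
        ‖y‖ ^ n / n.factorial := by
        gcongr
        exact h n
    _ = _ := by
        simp only [mul_pow, pow_add]
        field_simp

lemma subexp_F11 (c' y s : ℂ) : Subexp fun k : ℕ => F11 (s - k) c' y := fun ρ hρ => by
  obtain ⟨C, L, hC, hL, h⟩ := exists_bound_kummerTerm c' y s hρ
  have hs := Real.summable_pow_div_factorial L
  refine ⟨C * ∑' n : ℕ, L ^ n / n.factorial,
    mul_nonneg hC (tsum_nonneg fun n => by positivity), fun k => ?_⟩
  refine (tsum_of_norm_bounded (hs.hasSum.mul_left (C * ρ ^ k)) (h k)).trans_eq ?_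
  ring

lemma summable_mul_kummerTerm {t : ℕ → ℂ} (ht : Subexp t) (c' y s : ℂ) {z : ℂ} (hz : ‖z‖ < 1) :
    Summable fun p : ℕ × ℕ => t p.1 * z ^ p.1 * kummerTerm c' y (s - p.1) p.2 := by
  obtain ⟨r, hr, hr1⟩ := exists_between hz
  have hr0 : 0 < r := (norm_nonneg z).trans_lt hr
  have hρ : 1 < r⁻¹ := (one_lt_inv₀ hr0).2 hr1
  obtain ⟨C, L, hC, hL, h⟩ := exists_bound_kummerTerm c' y s hρ
  have hz' : ‖z * (r : ℂ)⁻¹‖ < 1 := by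
    rw [norm_mul, norm_inv, norm_real, Real.norm_of_nonneg hr0.le, ← div_eq_mul_inv]
    exact (div_lt_one hr0).2 hr
  have hs := ((summable_norm_mul_pow ht hz').mul_of_nonneg (Real.summable_pow_div_factorial L)
    (fun _ => by simp only [Pi.zero_apply]; positivity)
    (fun _ => by simp only [Pi.zero_apply]; positivity)).mul_left C
  refine Summable.of_norm_bounded hs fun p => ?_
  rw [norm_mul]
  refine (mul_le_mul_of_nonneg_left (h p.1 p.2) (norm_nonneg _)).trans_eq ?_
  rw [mul_pow, ← mul_assoc (t p.1), norm_mul _ ((r : ℂ)⁻¹ ^ p.1), norm_pow, norm_inv, norm_real,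
    Real.norm_of_nonneg hr0.le]
  ring

lemma tsum_tsum_kummerTerm {t : ℕ → ℂ} (ht : Subexp t) (c' y s : ℂ) {z : ℂ} (hz : ‖z‖ < 1) :
    ∑' n, ∑' k : ℕ, t k * z ^ k * kummerTerm c' y (s - k) n =
      pser (fun k => F11 (s - k) c' y * t k) z := by
  have hs := summable_mul_kummerTerm ht c' y s hz
  rw [Summable.tsum_comm (f := fun k n => t k * z ^ k * kummerTerm c' y (s - k) n) hs, pser]
  congr 1; ext k
  rw [tsum_mul_left, F11]
  simp only [kummerTerm]
  ring

lemma summable_tsum_kummerTerm {t : ℕ → ℂ} (ht : Subexp t) (c' y s : ℂ) {z : ℂ} (hz : ‖z‖ < 1) :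
    Summable fun n => ∑' k : ℕ, t k * z ^ k * kummerTerm c' y (s - k) n :=
  ((Equiv.prodComm ℕ ℕ).summable_iff.2 (summable_mul_kummerTerm ht c' y s hz)).prod

lemma gaussWeight_mul_fst {a b c : ℂ} (c' y : ℂ) (hab : ∀ n : ℤ, a - b ≠ n) (n : ℕ) {x : ℂ}
    (hx : x.re < -1) :
    gaussWeight a c' y n * (Gamma c * Gamma (b - (a + n)) / (Gamma b * Gamma (c - (a + n))) *
      gc (a + n) b c x) = Gamma c * Gamma (b - a) / (Gamma b * Gamma (c - a)) * (-x) ^ (-a) *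
      ∑' k : ℕ, hco a (1 - c + a) (1 - b + a) k * x⁻¹ ^ k * kummerTerm c' y (0 - k) n := by
  have hz := norm_inv_lt_one hx
  have hx0 : x ≠ 0 := by rintro rfl; norm_num at hx
  have hp : ∀ n : ℕ, 1 - b + a ≠ -n := fun n h =>
    hab (-n - 1) (by push_cast; linear_combination h)
  have hs := (((Equiv.prodComm ℕ ℕ).summable_iff.2 (summable_mul_kummerTerm
    (subexp_hco a (1 - c + a) (1 - b + a)) c' y 0 hz)).prod_factor n)
  simp only [Function.comp_apply, Equiv.prodComm_apply, Prod.swap_prod_mk] at hs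
  rw [← hs.sum_add_tsum_nat_add n, Finset.sum_eq_zero, zero_add, gc, gser, pser, ← mul_assoc,
    ← mul_assoc, ← tsum_mul_left, ← tsum_mul_left]
  · congr 1; ext m
    have g1 : Gamma (b - (a + n)) * poch (1 - b + a) n = (-1) ^ n * Gamma (b - a) := by
      have h1 := inv_Gamma_sub_natCast (b - a) n
      have h2 : Gamma (b - a) ≠ 0 := fun h => by
        obtain ⟨m, hm⟩ := (Gamma_eq_zero_iff _).1 h
        exact hab m (by push_cast; linear_combination -hm)
      have h3 : Gamma (b - a - n) ≠ 0 := fun h => by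
        obtain ⟨m, hm⟩ := (Gamma_eq_zero_iff _).1 h
        exact hab (m - n) (by push_cast; linear_combination -hm)
      rw [show 1 - (b - a) = 1 - b + a by ring] at h1
      rw [← sub_sub]
      field_simp at h1
      have h5 : ((-1 : ℂ) ^ n) * (-1) ^ n = 1 := by rw [← mul_pow]; simp
      linear_combination (-(-1) ^ n) * h1 - (Gamma (b - a - n) * poch (1 - b + a) n) * h5
    have g1' : Gamma (b - (a + n)) = (-1) ^ n * Gamma (b - a) * (poch (1 - b + a) n)⁻¹ := by
      rw [← g1, mul_inv_cancel_right₀ (poch_ne_zero hp n)]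
    have g2 : (Gamma (c - (a + n)))⁻¹ = (-1) ^ n * poch (1 - c + a) n * (Gamma (c - a))⁻¹ := by
      rw [← sub_sub, inv_Gamma_sub_natCast, show 1 - (c - a) = 1 - c + a by ring]
    have e : (-x) ^ (-(a + n)) = (-x) ^ (-a) * ((-1) ^ n * x⁻¹ ^ n) := by
      rw [neg_add, cpow_add _ _ (neg_ne_zero.2 hx0), cpow_neg _ (n : ℂ), cpow_natCast, ← inv_pow,
        inv_neg, neg_pow]
    have hk : hco a (1 - c + a) (1 - b + a) (m + n) * kummerTerm c' y (0 - ((m + n : ℕ) : ℂ)) n =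
        (-1) ^ n * gaussWeight a c' y n * (poch (1 - c + a) n * (poch (1 - b + a) n)⁻¹) *
          hco (a + n) (1 - c + (a + n)) (1 - b + (a + n)) m := by
      have f1 : ((m + n).factorial : ℂ) ≠ 0 := by exact_mod_cast (m + n).factorial_ne_zero
      have f2 : (m.factorial : ℂ) ≠ 0 := by exact_mod_cast m.factorial_ne_zero
      have f3 := poch_neg_natCast_add n m
      rw [← eq_div_iff f2] at f3
      rw [zero_sub, kummerTerm, f3]
      simp only [hco, gaussWeight]
      rw [add_comm m n, poch_add, poch_add, poch_add, add_assoc, add_assoc]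
      rw [add_comm m n] at f1
      rw [← mul_div_assoc]
      simp only [div_eq_mul_inv, mul_inv]
      linear_combination (poch a n * poch (a + n) m * poch (1 - c + a) n *
        poch (1 - c + (a + n)) m * (poch (1 - b + a) n)⁻¹ * (poch (1 - b + (a + n)) m)⁻¹ *
        (-1) ^ n * (m.factorial : ℂ)⁻¹ * (poch c' n)⁻¹ * y ^ n * (n.factorial : ℂ)⁻¹) *
        mul_inv_cancel₀ f1
    rw [mul_right_comm (hco _ _ _ _), hk, e, g1']
    simp only [div_eq_mul_inv, mul_inv]
    rw [g2, pow_add]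
    rcases neg_one_pow_eq_or ℂ n with h | h <;> rw [h] <;> ring
  · intro k hk
    rw [zero_sub, kummerTerm, poch_neg_natCast_of_lt (Finset.mem_range.1 hk)]
    simp

lemma gaussWeight_mul_snd {a b c : ℂ} (c' y : ℂ) (hab : ∀ n : ℤ, a - b ≠ n) (n : ℕ) {x : ℂ} :
    gaussWeight a c' y n * (Gamma c * Gamma (a + n - b) / (Gamma (a + n) * Gamma (c - b)) *
      gc b (a + n) c x) = Gamma c * Gamma (a - b) / (Gamma a * Gamma (c - b)) * (-x) ^ (-b) *
      ∑' k : ℕ, hco b (1 - c + b) (1 - a + b) k * x⁻¹ ^ k * kummerTerm c' y (a - b - k) n := by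
  have g1 := inv_Gamma_eq_poch_mul a n
  have g2 : Gamma (a + n - b) = poch (a - b) n * Gamma (a - b) := by
    have h1 := inv_Gamma_eq_poch_mul (a - b) n
    have h2 : Gamma (a - b) ≠ 0 := fun h => by
      obtain ⟨m, hm⟩ := (Gamma_eq_zero_iff _).1 h
      exact hab (-m) (by push_cast; linear_combination hm)
    have h3 : Gamma (a - b + n) ≠ 0 := fun h => by
      obtain ⟨m, hm⟩ := (Gamma_eq_zero_iff _).1 h
      exact hab (-m - n) (by push_cast; linear_combination hm)
    rw [add_sub_right_comm]
    field_simp at h1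
    linear_combination h1
  rw [gc, gser, pser, ← mul_assoc, ← mul_assoc, ← tsum_mul_left, ← tsum_mul_left]
  congr 1; ext k
  have p1 : poch (1 - a + b) k ≠ 0 := poch_ne_zero (fun m hm =>
    hab (m + 1) (by push_cast; linear_combination -hm)) k
  have p2 : poch (1 - (a + n) + b) k ≠ 0 := poch_ne_zero (fun m hm =>
    hab (m + 1 - n) (by push_cast; linear_combination -hm)) k
  have p3 := poch_mul_poch_one_sub (a - b) n k
  rw [show 1 - (a - b) = 1 - a + b by ring, show 1 - a + b - n = 1 - (a + n) + b by ring] at p3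
  have p4 : poch (a - b) n * (poch (1 - (a + n) + b) k)⁻¹ =
      poch (a - b - k) n * (poch (1 - a + b) k)⁻¹ := by
    rw [← div_eq_mul_inv, ← div_eq_mul_inv, div_eq_div_iff p2 p1, p3]
  rw [g2]
  simp only [gaussWeight, hco, kummerTerm, div_eq_mul_inv, mul_inv]
  rw [g1]
  linear_combination (poch a n * y ^ n * (poch c' n)⁻¹ * (n.factorial : ℂ)⁻¹ * Gamma c *
    Gamma (a - b) * (Gamma (a + n))⁻¹ * (Gamma (c - b))⁻¹ * (-x) ^ (-b) * poch b k *
    poch (1 - c + b) k * (k.factorial : ℂ)⁻¹ * x⁻¹ ^ k) * p4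

/-- The expansion at infinity. -/
noncomputable def humbertInfinity (a b c c' y x : ℂ) : ℂ :=
  Gamma c * Gamma (b - a) / (Gamma b * Gamma (c - a)) * (-x) ^ (-a) *
      pser (fun k => F11 (0 - k) c' y * hco a (1 - c + a) (1 - b + a) k) x⁻¹ +
    Gamma c * Gamma (a - b) / (Gamma a * Gamma (c - b)) * (-x) ^ (-b) *
      pser (fun k => F11 (a - b - k) c' y * hco b (1 - c + b) (1 - a + b) k) x⁻¹

lemma tsum_gaussWeight_mul_fc_eq {a b c : ℂ} (c' y : ℂ) (hc : ∀ n : ℕ, c ≠ -n)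
    (hab : ∀ n : ℤ, a - b ≠ n) {x : ℂ} (hx : x.re < -1) :
    ∑' n, gaussWeight a c' y n * fc (a + n) b c x = humbertInfinity a b c c' y x := by
  have hz := norm_inv_lt_one hx
  have hab' (n : ℕ) : ∀ m : ℤ, a + n - b ≠ m := fun m hm =>
    hab (m - n) (by push_cast; linear_combination hm)
  have h (n : ℕ) := connection_formula hc (hab' n) hx
  simp only [h, mul_add, gaussWeight_mul_fst c' y hab _ hx, gaussWeight_mul_snd c' y hab]
  have s1 := summable_tsum_kummerTerm (subexp_hco a (1 - c + a) (1 - b + a)) c' y 0 hz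
  have s2 := summable_tsum_kummerTerm (subexp_hco b (1 - c + b) (1 - a + b)) c' y (a - b) hz
  rw [(s1.mul_left _).tsum_add (s2.mul_left _), tsum_mul_left, tsum_mul_left,
    tsum_tsum_kummerTerm (subexp_hco _ _ _) c' y _ hz,
    tsum_tsum_kummerTerm (subexp_hco _ _ _) c' y _ hz, humbertInfinity]

lemma differentiableAt_humbertInfinity (a b c c' y : ℂ) {x : ℂ} (hx1 : 1 < ‖x‖)
    (hx : -x ∈ slitPlane) : DifferentiableAt ℂ (humbertInfinity a b c c' y) x := by
  have hx0 : x ≠ 0 := norm_pos_iff.1 (one_pos.trans hx1)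
  have hz : ‖x⁻¹‖ < 1 := by rw [norm_inv]; exact inv_lt_one_of_one_lt₀ hx1
  have d1 (s : ℂ) : DifferentiableAt ℂ (fun x : ℂ => (-x) ^ (-s)) x :=
    differentiableAt_id.neg.cpow_const hx
  have d2 {t : ℕ → ℂ} (ht : Subexp t) : DifferentiableAt ℂ (fun x : ℂ => pser t x⁻¹) x :=
    (differentiableAt_pser ht hz).comp x (differentiableAt_inv hx0)
  exact (((d1 a).const_mul _).mul (d2 ((subexp_F11 c' y 0).mul (subexp_hco _ _ _)))).add
    (((d1 b).const_mul _).mul (d2 ((subexp_F11 c' y (a - b)).mul (subexp_hco _ _ _))))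

/-- The strip mapped by `z ↦ -exp z` onto the domain of the expansion at infinity. -/
def strip : Set ℂ := {z | 0 < z.re} ∩ ({z | -Real.pi < z.im} ∩ {z | z.im < Real.pi})

lemma isOpen_strip : IsOpen strip :=
  (isOpen_lt continuous_const continuous_re).inter
    ((isOpen_lt continuous_const continuous_im).inter (isOpen_lt continuous_im continuous_const))

lemma convex_strip : Convex ℝ strip :=
  (convex_halfSpace_re_gt 0).inter ((convex_halfSpace_im_gt _).inter (convex_halfSpace_im_lt _))

lemma exp_mem_slitPlane_of_mem_strip {z : ℂ} (hz : z ∈ strip) : exp z ∈ slitPlane := by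
  obtain ⟨-, h1, h2⟩ := hz
  rw [mem_slitPlane_iff_arg, ← log_im, Complex.log_exp h1 (le_of_lt h2)]
  exact ⟨ne_of_lt h2, exp_ne_zero z⟩

lemma one_lt_norm_exp_of_mem_strip {z : ℂ} (hz : z ∈ strip) : 1 < ‖exp z‖ := by
  rw [norm_exp]
  exact Real.one_lt_exp_iff.2 hz.1

lemma neg_mem_slitPlane_iff {x : ℂ} : -x ∈ slitPlane ↔ x.im ≠ 0 ∨ x.re < 0 := by
  rw [mem_slitPlane_iff, neg_re, neg_im, neg_pos, neg_ne_zero, or_comm]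

theorem eq_humbertInfinity {a b c c' y : ℂ} (hc : ∀ n : ℕ, c ≠ -n) (hab : ∀ n : ℤ, a - b ≠ n)
    {Ψ : ℂ → ℂ} (hΨ : AnalyticOn ℂ Ψ {x : ℂ | x.im ≠ 0 ∨ x.re < 1})
    (hser : ∀ x : ℂ, ‖x‖ < 1 → Ψ x = ∑' p, humbertTerm a b c c' x y p) {x : ℂ}
    (hx1 : 1 < ‖x‖) (hx2 : x.im ≠ 0 ∨ x.re < 0) : Ψ x = humbertInfinity a b c c' y x := by
  have hd : DifferentiableOn ℂ (fun z => Ψ (-exp z)) strip := by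
    refine hΨ.differentiableOn.comp (f := fun z => -exp z) (by fun_prop) fun z hz => ?_
    have := exp_mem_slitPlane_of_mem_strip hz
    rw [← neg_neg (exp z), neg_mem_slitPlane_iff] at this
    exact this.imp id fun h => h.trans one_pos
  have hd' : DifferentiableOn ℂ (fun z => humbertInfinity a b c c' y (-exp z)) strip := by
    intro z hz
    refine DifferentiableAt.differentiableWithinAt ?_
    refine DifferentiableAt.comp (f := fun z => -exp z) z
      (differentiableAt_humbertInfinity a b c c' y (x := -exp z) ?_ ?_) (by fun_prop)
    · rw [norm_neg]
      exact one_lt_norm_exp_of_mem_strip hz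
    · rw [neg_neg]
      exact exp_mem_slitPlane_of_mem_strip hz
  have h1 : (1 : ℂ) ∈ strip := by
    refine ⟨by simp, ?_, ?_⟩ <;> simp [Real.pi_pos]
  have hev : (fun z => Ψ (-exp z)) =ᶠ[𝓝 1] fun z => humbertInfinity a b c c' y (-exp z) := by
    have hc1 : ContinuousAt (fun z : ℂ => (-exp z).re) 1 := by fun_prop
    have : (-exp (1 : ℂ)).re < -1 := by
      rw [neg_re, ← ofReal_one, exp_ofReal_re]
      exact neg_lt_neg (Real.one_lt_exp_iff.2 one_pos)
    filter_upwards [hc1.eventually_lt_const this] with z hz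
    rw [eq_tsum_gaussWeight_mul_fc hc hΨ hser (by linarith),
      tsum_gaussWeight_mul_fc_eq c' y hc hab hz]
  have hx0 : -x ≠ 0 := neg_ne_zero.2 (norm_pos_iff.1 (one_pos.trans hx1))
  have hlog : log (-x) ∈ strip := by
    have ha := mem_slitPlane_iff_arg.1 (neg_mem_slitPlane_iff.2 hx2)
    refine ⟨?_, ?_, ?_⟩
    · change 0 < (log (-x)).re
      rw [log_re, norm_neg]
      exact Real.log_pos hx1
    · change -Real.pi < (log (-x)).im
      rw [log_im]
      exact neg_pi_lt_arg _
    · change (log (-x)).im < Real.pi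
      rw [log_im]
      exact lt_of_le_of_ne (arg_le_pi _) ha.1
  have := (hd.analyticOnNhd isOpen_strip).eqOn_of_preconnected_of_eventuallyEq
    (hd'.analyticOnNhd isOpen_strip) convex_strip.isPreconnected h1 hev hlog
  simpa only [exp_log hx0, neg_neg] using this

end Psi1

/-- Convergent expansion of the analytic continuation of the Humbert function
`Ψ₁` (in its first variable, with `y` fixed) for `|arg(−x)| < π` and `|x| > 1`.
Here `Ψ` is any analytic continuation of the double series defining `Ψ₁` to the
cut plane `ℂ \ [1, ∞)`. -/
theorem psi1_expansion_large_x (a b c c' y : ℂ)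
    (hc : ∀ n : ℕ, c ≠ -n) (hc' : ∀ n : ℕ, c' ≠ -n)
    (hab : ∀ n : ℤ, a - b ≠ n)
    (Ψ : ℂ → ℂ)
    (hΨ : AnalyticOn ℂ Ψ {x : ℂ | x.im ≠ 0 ∨ x.re < 1})
    (hser : ∀ x : ℂ, ‖x‖ < 1 →
      Ψ x = ∑' p : ℕ × ℕ, poch a (p.1 + p.2) * poch b p.1 /
        (poch c p.1 * poch c' p.2) * x ^ p.1 * y ^ p.2 /
        ((Nat.factorial p.1 : ℂ) * (Nat.factorial p.2 : ℂ)))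
    (x : ℂ) (hx1 : 1 < ‖x‖) (hx2 : x.im ≠ 0 ∨ x.re < 0) :
    Ψ x = Complex.Gamma c * Complex.Gamma (b - a) /
            (Complex.Gamma b * Complex.Gamma (c - a)) * (-x) ^ (-a) *
          (∑' k : ℕ, F11 (-(k : ℂ)) c' y *
            (poch a k * poch (1 - c + a) k /
              (poch (1 - b + a) k * (Nat.factorial k : ℂ))) * x⁻¹ ^ k)
        + Complex.Gamma c * Complex.Gamma (a - b) /
            (Complex.Gamma a * Complex.Gamma (c - b)) * (-x) ^ (-b) *
          (∑' k : ℕ, F11 (a - b - k) c' y *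
            (poch b k * poch (1 - c + b) k /
              (poch (1 - a + b) k * (Nat.factorial k : ℂ))) * x⁻¹ ^ k) := by
  refine (Psi1.eq_humbertInfinity hc hab hΨ hser hx1 hx2).trans ?_
  simp only [Psi1.humbertInfinity, Psi1.pser, Psi1.hco, zero_sub]
end

section
/- As a consequence of the small-y expansion of Ψ₁, for fixed y > 0 and x → +∞, Ψ₁[1, 1/2; 3/2, 1/2; −x, y/x] = (π/2) x^{−1/2} − x^{−1} + O(x^{−3/2}); in particular the two leading terms are independent of y. -/
open Complex MeasureTheory Filter Topology

/-- Confluent hypergeometric limit function `₀F₁[−; b; z]`. -/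
noncomputable def F01 (b z : ℂ) : ℂ :=
  ∑' k : ℕ, z ^ k / (poch b k * (Nat.factorial k : ℂ))

/-- The Humbert function `Ψ₁[a,b;c,c';x,y]` given by its Laplace-type integral
representation, valid for `Re a > 0` and `Re x < 1` (and providing the analytic
continuation of the double series to negative real `x`). -/
noncomputable def Psi1 (a b c c' x y : ℂ) : ℂ :=
  (Complex.Gamma a)⁻¹ *
    ∫ u in Set.Ioi (0 : ℝ), (u : ℂ) ^ (a - 1) * Complex.exp (-(u : ℂ)) *
      F11 b c (x * u) * F01 c' (y * u)

/-- The real integral `∫₀¹ exp (-z t²) dt`, which represents `₁F₁[1/2; 3/2; -z]`. -/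
noncomputable def gaussUnit (z : ℝ) : ℝ := ∫ t in (0 : ℝ)..1, Real.exp (-z * t ^ 2)

lemma poch_succ (a : ℂ) (n : ℕ) : poch a (n + 1) = poch a n * (a + n) :=
  ascPochhammer_succ_eval n a

lemma poch_half_mul_factorial (k : ℕ) :
    poch (1 / 2) k * (Nat.factorial k : ℂ) * 4 ^ k = (Nat.factorial (2 * k) : ℂ) := by
  induction k with
  | zero => simp [poch]
  | succ k ih =>
    rw [show 2 * (k + 1) = 2 * k + 1 + 1 by ring, Nat.factorial_succ, Nat.factorial_succ,
      Nat.factorial_succ, poch_succ, pow_succ]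
    push_cast
    rw [← ih]
    ring

lemma poch_half_ne_zero (k : ℕ) : poch (1 / 2) k ≠ 0 := by
  intro h
  have := poch_half_mul_factorial k
  rw [h, zero_mul, zero_mul] at this
  exact Nat.cast_ne_zero.mpr (Nat.factorial_ne_zero (2 * k)) this.symm

lemma poch_three_half (k : ℕ) : poch (3 / 2) k = poch (1 / 2) k * (2 * k + 1) := by
  induction k with
  | zero => simp [poch]
  | succ k ih =>
    rw [poch_succ, ih, poch_succ]
    push_cast
    ring

lemma F01_half_eq_cosh {w : ℝ} (hw : 0 ≤ w) :
    F01 (1 / 2) (w : ℂ) = (Real.cosh (2 * √w) : ℂ) := by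
  rw [Complex.ofReal_cosh, Complex.cosh_eq_tsum, F01]
  refine tsum_congr fun k => ?_
  have h : ((2 * √w : ℝ) : ℂ) ^ (2 * k) = 4 ^ k * (w : ℂ) ^ k := by
    rw [pow_mul, ← mul_pow]
    congr 1
    norm_cast
    rw [mul_pow, Real.sq_sqrt hw]
    norm_num
  have h4 : (4 : ℂ) ^ k ≠ 0 := pow_ne_zero _ (by norm_num)
  rw [h, ← poch_half_mul_factorial k, mul_comm ((4 : ℂ) ^ k), mul_div_mul_right _ _ h4]

lemma F11_half_eq_gaussUnit (z : ℝ) :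
    F11 (1 / 2) (3 / 2) (-(z : ℂ)) = (gaussUnit z : ℂ) := by
  let f : ℕ → C(ℝ, ℝ) := fun n => ⟨fun t => (-z * t ^ 2) ^ n / (Nat.factorial n : ℝ), by fun_prop⟩
  have hsum : Summable fun n : ℕ =>
      ‖(f n).restrict (⟨Set.uIcc 0 1, isCompact_uIcc⟩ : TopologicalSpace.Compacts ℝ)‖ := by
    refine Summable.of_nonneg_of_le (fun n => norm_nonneg _) (fun n => ?_)
      (Real.summable_pow_div_factorial |z|)
    refine (ContinuousMap.norm_le _ (by positivity)).mpr fun t => ?_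
    obtain ⟨t, ht⟩ := t
    have ht' : t ∈ Set.Icc (0 : ℝ) 1 := by simpa [Set.uIcc_of_le] using ht
    have ht2 : t ^ 2 ≤ 1 := pow_le_one₀ ht'.1 ht'.2
    change |(-z * t ^ 2) ^ n / (Nat.factorial n : ℝ)| ≤ _
    rw [abs_div, Nat.abs_cast, abs_pow, abs_mul, abs_neg, abs_of_nonneg (sq_nonneg t)]
    gcongr
    exact mul_le_of_le_one_right (abs_nonneg z) ht2
  have h := intervalIntegral.hasSum_intervalIntegral_of_summable_norm hsum
  have hexp : (∫ t in (0 : ℝ)..1, ∑' n, f n t) = gaussUnit z := by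
    simp only [gaussUnit, Real.exp_eq_exp_ℝ, NormedSpace.exp_eq_tsum_div]
    rfl
  rw [hexp] at h
  rw [F11, ← h.tsum_eq, Complex.ofReal_tsum]
  refine tsum_congr fun n => ?_
  have hterm : (∫ t in (0 : ℝ)..1, f n t) = (-z) ^ n / (Nat.factorial n : ℝ) / (2 * n + 1) := by
    change (∫ t in (0 : ℝ)..1, (-z * t ^ 2) ^ n / (Nat.factorial n : ℝ)) = _
    simp only [mul_pow, ← pow_mul, intervalIntegral.integral_div,
      intervalIntegral.integral_const_mul, integral_pow]
    push_cast
    simp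
    ring
  rw [hterm, poch_three_half, div_mul_cancel_left₀ (poch_half_ne_zero n)]
  push_cast
  field_simp

lemma gaussUnit_nonneg (z : ℝ) : 0 ≤ gaussUnit z :=
  intervalIntegral.integral_nonneg zero_le_one fun _ _ => (Real.exp_pos _).le

lemma gaussUnit_le {z : ℝ} (hz : 0 < z) : gaussUnit z ≤ 1 / √z := by
  have h : gaussUnit z ≤ √(Real.pi / z) / 2 := by
    rw [← integral_gaussian_Ioi, gaussUnit, intervalIntegral.integral_of_le zero_le_one]
    exact setIntegral_mono_set (integrable_exp_neg_mul_sq hz).integrableOn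
      (Eventually.of_forall fun _ => (Real.exp_pos _).le)
      (LE.le.eventuallyLE Set.Ioc_subset_Ioi_self)
  refine h.trans ?_
  have hpi : √Real.pi ≤ 2 :=
    (Real.sqrt_le_left (by norm_num)).mpr (by linarith [Real.pi_le_four])
  rw [Real.sqrt_div Real.pi_pos.le, div_right_comm]
  gcongr
  linarith

lemma integrable_exp_mul_exp {x : ℝ} (hx : 0 < x) :
    Integrable (Function.uncurry fun u t : ℝ => Real.exp (-u) * Real.exp (-(x * u) * t ^ 2))
      ((volume.restrict (Set.Ioi 0)).prod (volume.restrict (Set.Ioc 0 1))) := by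
  have hdom := (integrableOn_exp_neg_Ioi 0).integrable.mul_prod
    (integrable_const (1 : ℝ) (μ := volume.restrict (Set.Ioc (0 : ℝ) 1)))
  refine hdom.mono' (by fun_prop) ?_
  rw [Measure.prod_restrict]
  refine (ae_restrict_iff' (measurableSet_Ioi.prod measurableSet_Ioc)).mpr
    (Eventually.of_forall fun p hp => ?_)
  have hu : 0 < p.1 := hp.1
  simp only [Function.uncurry, norm_mul, Real.norm_eq_abs, Real.abs_exp]
  gcongr
  rw [Real.exp_le_one_iff]
  have := mul_nonneg (mul_pos hx hu).le (sq_nonneg p.2)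
  linarith

lemma integrableOn_exp_mul_gaussUnit {x : ℝ} (hx : 0 < x) :
    IntegrableOn (fun u => Real.exp (-u) * gaussUnit (x * u)) (Set.Ioi 0) := by
  refine (integrable_exp_mul_exp hx).integral_prod_left.congr (Eventually.of_forall fun u => ?_)
  simp [gaussUnit, intervalIntegral.integral_of_le, integral_const_mul]

lemma integral_exp_mul_gaussUnit {x : ℝ} (hx : 0 < x) :
    ∫ u in Set.Ioi 0, Real.exp (-u) * gaussUnit (x * u) = Real.arctan √x / √x := by
  have hs : 0 < √x := Real.sqrt_pos.mpr hx
  have h1 (u : ℝ) : Real.exp (-u) * gaussUnit (x * u) =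
      ∫ t in Set.Ioc (0 : ℝ) 1, Real.exp (-u) * Real.exp (-(x * u) * t ^ 2) := by
    rw [gaussUnit, intervalIntegral.integral_of_le zero_le_one, integral_const_mul]
  have h2 (t : ℝ) : ∫ u in Set.Ioi 0, Real.exp (-u) * Real.exp (-(x * u) * t ^ 2) =
      (1 + (√x * t) ^ 2)⁻¹ := by
    have hneg : -(1 + (√x * t) ^ 2) < 0 := by nlinarith [sq_nonneg (√x * t)]
    have := integral_exp_mul_Ioi hneg 0
    rw [mul_zero, Real.exp_zero, neg_div_neg_eq, one_div] at this
    rw [← this]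
    refine integral_congr_ae (Eventually.of_forall fun u => ?_)
    simp only [← Real.exp_add, mul_pow, Real.sq_sqrt hx.le]
    congr 1
    ring
  simp_rw [h1]
  rw [integral_integral_swap (integrable_exp_mul_exp hx)]
  simp_rw [h2]
  rw [← intervalIntegral.integral_of_le zero_le_one,
    intervalIntegral.integral_comp_mul_left (fun t => (1 + t ^ 2)⁻¹) hs.ne',
    integral_inv_one_add_sq]
  simp [div_eq_inv_mul]

lemma abs_arctan_sub_self_le {s : ℝ} (hs : 0 ≤ s) : |Real.arctan s - s| ≤ s ^ 2 := by
  have h0 : 0 ≤ Real.arctan s := Real.arctan_nonneg.mpr hs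
  have hup : Real.arctan s ≤ s := by
    simpa using Real.le_tan h0 (Real.arctan_lt_pi_div_two s)
  have hlow : s / √(1 + s ^ 2) ≤ Real.arctan s := by
    simpa [Real.sin_arctan] using Real.sin_le h0
  have hsqrt : √(1 + s ^ 2) ≤ 1 + s :=
    Real.sqrt_le_iff.mpr ⟨by linarith, by nlinarith⟩
  have hdiv : s / (1 + s) ≤ s / √(1 + s ^ 2) := by gcongr
  have hsub : s - s ^ 2 ≤ s / (1 + s) := by
    rw [le_div_iff₀ (by linarith)]
    nlinarith [pow_nonneg hs 3]
  rw [abs_le]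
  constructor <;> nlinarith [sq_nonneg s]

lemma cosh_two_mul_sqrt_sub_one_le {w : ℝ} (hw : 0 ≤ w) :
    Real.cosh (2 * √w) - 1 ≤ 2 * w * Real.exp (2 * w) := by
  have h := Real.cosh_le_exp_half_sq (2 * √w)
  rw [mul_pow, Real.sq_sqrt hw, show (2 : ℝ) ^ 2 * w / 2 = 2 * w by ring] at h
  have h2 : (1 - 2 * w) * Real.exp (2 * w) ≤ 1 := by
    calc (1 - 2 * w) * Real.exp (2 * w) ≤ Real.exp (-(2 * w)) * Real.exp (2 * w) := by
          gcongr
          exact Real.one_sub_le_exp_neg _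
      _ = 1 := by rw [← Real.exp_add]; simp
  linarith

lemma rpow_neg_three_half_eq {x : ℝ} (hx : 0 < x) :
    x ^ (-(3 / 2) : ℝ) = (√x)⁻¹ ^ 3 := by
  rw [Real.sqrt_eq_rpow, ← Real.rpow_neg hx.le, ← Real.rpow_natCast, ← Real.rpow_mul hx.le]
  norm_num

lemma Psi1_eq_ofReal_integral {x y : ℝ} (hx : 0 < x) (hy : 0 < y) :
    Psi1 1 (1 / 2) (3 / 2) (1 / 2) (-(x : ℂ)) ((y / x : ℝ) : ℂ) =
      ((∫ u in Set.Ioi 0, Real.exp (-u) * gaussUnit (x * u) *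
        Real.cosh (2 * √(y / x * u)) : ℝ) : ℂ) := by
  rw [Psi1, Complex.Gamma_one, inv_one, one_mul, ← integral_complex_ofReal]
  refine setIntegral_congr_fun measurableSet_Ioi fun u hu => ?_
  have hu' : 0 < u := hu
  have h1 : -(x : ℂ) * u = -((x * u : ℝ) : ℂ) := by push_cast; ring
  have h2 : ((y / x : ℝ) : ℂ) * u = ((y / x * u : ℝ) : ℂ) := by push_cast; ring
  simp only [sub_self, Complex.cpow_zero, one_mul]
  rw [h1, h2, F11_half_eq_gaussUnit, F01_half_eq_cosh (by positivity)]
  push_cast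
  rfl

/-- Integrable majorant, up to the factor `x ^ (-3/2)`, of the `y`-dependent part of the
integrand. -/
lemma remainder_bound {x y u : ℝ} (hy : 0 < y) (hxy : 4 * y ≤ x) (hu : 0 < u) :
    Real.exp (-u) * gaussUnit (x * u) * (Real.cosh (2 * √(y / x * u)) - 1) ≤
      2 * y * (√x)⁻¹ ^ 3 * (u ^ (1 / 2 : ℝ) * Real.exp (-(1 / 2) * u ^ (1 : ℝ))) := by
  have hx : 0 < x := by linarith
  have hw : 0 ≤ y / x * u := by positivity
  have hwu : 2 * (y / x * u) ≤ u / 2 := by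
    have : y / x ≤ 1 / 4 := by rw [div_le_iff₀ hx]; linarith
    nlinarith
  calc Real.exp (-u) * gaussUnit (x * u) * (Real.cosh (2 * √(y / x * u)) - 1)
      ≤ Real.exp (-u) * (1 / √(x * u)) * (2 * (y / x * u) * Real.exp (u / 2)) := by
        have h1 := gaussUnit_le (mul_pos hx hu)
        have h2 : Real.cosh (2 * √(y / x * u)) - 1 ≤ 2 * (y / x * u) * Real.exp (u / 2) :=
          (cosh_two_mul_sqrt_sub_one_le hw).trans (by gcongr)
        have h3 : 0 ≤ Real.cosh (2 * √(y / x * u)) - 1 := sub_nonneg.mpr (Real.one_le_cosh _)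
        gcongr
    _ = 2 * y * (√x)⁻¹ ^ 3 * (u ^ (1 / 2 : ℝ) * Real.exp (-(1 / 2) * u ^ (1 : ℝ))) := by
        have he : Real.exp (-(1 / 2) * u ^ (1 : ℝ)) = Real.exp (-u) * Real.exp (u / 2) := by
          rw [Real.rpow_one, ← Real.exp_add]
          congr 1
          ring
        rw [he, ← Real.sqrt_eq_rpow, Real.sqrt_mul hx.le]
        have hsx : √x ≠ 0 := (Real.sqrt_pos.mpr hx).ne'
        have hsu : √u ≠ 0 := (Real.sqrt_pos.mpr hu).ne'
        obtain ⟨a, ha⟩ : ∃ a, a = √x := ⟨_, rfl⟩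
        obtain ⟨b, hb⟩ : ∃ b, b = √u := ⟨_, rfl⟩
        have hxa : x = a ^ 2 := by rw [ha, Real.sq_sqrt hx.le]
        have hub : u = b ^ 2 := by rw [hb, Real.sq_sqrt hu.le]
        rw [← ha] at hsx ⊢
        rw [← hb] at hsu ⊢
        have hdiv : y / x * u = y / a ^ 2 * b ^ 2 := by rw [hxa, hub]
        rw [hdiv]
        field_simp

lemma integrableOn_sqrt_mul_exp :
    IntegrableOn (fun u : ℝ => u ^ (1 / 2 : ℝ) * Real.exp (-(1 / 2) * u ^ (1 : ℝ))) (Set.Ioi 0) :=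
  integrableOn_rpow_mul_exp_neg_mul_rpow (by norm_num) one_pos (by norm_num)

lemma abs_integral_sub_le {x y : ℝ} (hy : 0 < y) (hxy : 4 * y ≤ x) :
    |(∫ u in Set.Ioi 0, Real.exp (-u) * gaussUnit (x * u) * Real.cosh (2 * √(y / x * u))) -
        Real.arctan √x / √x| ≤
      2 * y * (∫ u in Set.Ioi (0 : ℝ), u ^ (1 / 2 : ℝ) * Real.exp (-(1 / 2) * u ^ (1 : ℝ))) *
        (√x)⁻¹ ^ 3 := by
  have hx : 0 < x := by linarith
  have hA := integrableOn_exp_mul_gaussUnit hx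
  have hK := integrableOn_sqrt_mul_exp.const_mul (2 * y * (√x)⁻¹ ^ 3)
  have hnn (u : ℝ) :
      0 ≤ Real.exp (-u) * gaussUnit (x * u) * (Real.cosh (2 * √(y / x * u)) - 1) :=
    mul_nonneg (mul_nonneg (Real.exp_pos _).le (gaussUnit_nonneg _))
      (sub_nonneg.mpr (Real.one_le_cosh _))
  have hR : IntegrableOn (fun u => Real.exp (-u) * gaussUnit (x * u) *
      (Real.cosh (2 * √(y / x * u)) - 1)) (Set.Ioi 0) := by
    refine Integrable.mono' hK (hA.aestronglyMeasurable.mul (Continuous.aestronglyMeasurable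
      (by fun_prop))) ((ae_restrict_iff' measurableSet_Ioi).mpr (Eventually.of_forall fun u hu => ?_))
    rw [Real.norm_of_nonneg (hnn u)]
    exact remainder_bound hy hxy hu
  have hsplit : (∫ u in Set.Ioi 0, Real.exp (-u) * gaussUnit (x * u) *
      Real.cosh (2 * √(y / x * u))) = Real.arctan √x / √x +
      ∫ u in Set.Ioi 0, Real.exp (-u) * gaussUnit (x * u) *
        (Real.cosh (2 * √(y / x * u)) - 1) := by
    rw [← integral_exp_mul_gaussUnit hx, ← integral_add hA hR]
    refine integral_congr_ae (Eventually.of_forall fun u => ?_)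
    simp only
    ring
  rw [hsplit, add_sub_cancel_left, abs_of_nonneg (integral_nonneg hnn), mul_right_comm,
    ← integral_const_mul]
  exact setIntegral_mono_on hR hK measurableSet_Ioi fun u hu => remainder_bound hy hxy hu

lemma abs_arctan_sqrt_div_sub_le {x : ℝ} (hx : 0 < x) :
    |Real.arctan √x / √x - (Real.pi / 2 * (√x)⁻¹ - x⁻¹)| ≤ (√x)⁻¹ ^ 3 := by
  have hs : 0 < √x := Real.sqrt_pos.mpr hx
  have harc := Real.arctan_inv_of_pos hs
  have hx' : x⁻¹ = (√x)⁻¹ * (√x)⁻¹ := by rw [← mul_inv, Real.mul_self_sqrt hx.le]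
  have heq : Real.arctan √x / √x - (Real.pi / 2 * (√x)⁻¹ - x⁻¹) =
      -((Real.arctan (√x)⁻¹ - (√x)⁻¹) * (√x)⁻¹) := by
    rw [harc, hx', div_eq_mul_inv]
    ring
  rw [heq, abs_neg, abs_mul, abs_of_pos (inv_pos.mpr hs), pow_succ]
  gcongr
  exact abs_arctan_sub_self_le (inv_pos.mpr hs).le

/-- For fixed `y > 0`, as `x → +∞`,
`Ψ₁[1,1/2;3/2,1/2;−x,y/x] = (π/2) x^{−1/2} − x^{−1} + O(x^{−3/2})`;
in particular the two leading terms are independent of `y`. -/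
theorem psi1_glauber_ising_asymptotics (y : ℝ) (hy : 0 < y) :
    (fun x : ℝ =>
        Psi1 1 (1 / 2) (3 / 2) (1 / 2) (-(x : ℂ)) ((y / x : ℝ) : ℂ) -
          (((Real.pi / 2 : ℝ) : ℂ) * (x : ℂ) ^ (-(1 / 2 : ℂ)) - (x : ℂ)⁻¹))
      =O[atTop] fun x : ℝ => x ^ (-(3 / 2) : ℝ) := by
  refine Asymptotics.IsBigO.of_bound (2 * y * (∫ u in Set.Ioi (0 : ℝ),
    u ^ (1 / 2 : ℝ) * Real.exp (-(1 / 2) * u ^ (1 : ℝ))) + 1) ?_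
  filter_upwards [eventually_ge_atTop (4 * y)] with x hxy
  have hx : 0 < x := by linarith
  have hpow : (x : ℂ) ^ (-(1 / 2 : ℂ)) = (((√x)⁻¹ : ℝ) : ℂ) := by
    rw [Real.sqrt_eq_rpow, ← Real.rpow_neg hx.le, Complex.ofReal_cpow hx.le]
    push_cast
    rfl
  rw [Psi1_eq_ofReal_integral hx hy, hpow, ← Complex.ofReal_mul, ← Complex.ofReal_inv,
    ← Complex.ofReal_sub, ← Complex.ofReal_sub, Complex.norm_real, Real.norm_eq_abs,
    rpow_neg_three_half_eq hx, Real.norm_of_nonneg (by positivity), add_mul, one_mul]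
  exact (abs_sub_le _ (Real.arctan √x / √x) _).trans
    (add_le_add (abs_integral_sub_le hy hxy) (abs_arctan_sqrt_div_sub_le hx))
end
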